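/- arXiv:1701.03955 — 7 statements merged into one kernel-verified Lean document; each statement's English description precedes it below -/
import Mathlib

section
/- For every integer N ≥ 1 and every p ∈ [1,∞), the metric space (𝒫^p(ℝ^N), d_p^nd) is separable: there exists a countable subset of 𝒫^p(ℝ^N) that is dense with respect to the nested distance d_p^nd. -/
open MeasureTheory ProbabilityTheory Filter
open scoped ENNReal NNReal Topology

noncomputable section

/-- `dund` is a metric on `ℝ` inducing the usual topology. -/
structure IsCompatibleMetric (dund : ℝ → ℝ → ℝ) : Prop where
  self_eq_zero : ∀ x, dund x x = 0
  eq_of_dist_eq_zero : ∀ x y, dund x y = 0 → x = y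
  symm : ∀ x y, dund x y = dund y x
  triangle : ∀ x y z, dund x z ≤ dund x y + dund y z
  compatible : ∀ (x : ℝ) (u : ℕ → ℝ),
    Tendsto u atTop (nhds x) ↔ Tendsto (fun n => dund (u n) x) atTop (nhds 0)

/-- Couplings: measures on the product with prescribed marginals. -/
def coupling {α β : Type*} [MeasurableSpace α] [MeasurableSpace β]
    (μ : Measure α) (ν : Measure β) : Set (Measure (α × β)) :=
  {γ | γ.map Prod.fst = μ ∧ γ.map Prod.snd = ν}

/-- Projection onto the first `t` coordinates. -/
def proj (N t : ℕ) (ht : t ≤ N) (x : Fin N → ℝ) : Fin t → ℝ :=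
  fun i => x (Fin.castLE ht i)

/-- The σ-algebra generated by the first `t` coordinates of the first (`x`) component. -/
def sigmaX (N t : ℕ) (ht : t ≤ N) : MeasurableSpace ((Fin N → ℝ) × (Fin N → ℝ)) :=
  MeasurableSpace.comap (fun z => proj N t ht z.1) inferInstance

/-- The σ-algebra generated by the first `t` coordinates of the second (`y`) component. -/
def sigmaY (N t : ℕ) (ht : t ≤ N) : MeasurableSpace ((Fin N → ℝ) × (Fin N → ℝ)) :=
  MeasurableSpace.comap (fun z => proj N t ht z.2) inferInstance

/-- The σ-algebra generated by all coordinates of the first (`x`) component. -/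
def sigmaXfull (N : ℕ) : MeasurableSpace ((Fin N → ℝ) × (Fin N → ℝ)) :=
  MeasurableSpace.comap Prod.fst inferInstance

/-- The σ-algebra generated by all coordinates of the second (`y`) component. -/
def sigmaYfull (N : ℕ) : MeasurableSpace ((Fin N → ℝ) × (Fin N → ℝ)) :=
  MeasurableSpace.comap Prod.snd inferInstance

/-- A coupling `γ`, viewed as the joint law of processes `X, Y`, is bicausal if for every
`t < N` and Borel `B ⊆ ℝ^t`, `ℙ((Y₁,…,Y_t) ∈ B | X₁,…,X_N) = ℙ((Y₁,…,Y_t) ∈ B | X₁,…,X_t)`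
a.s. and symmetrically in `X` and `Y`. -/
def Bicausal (N : ℕ) (γ : Measure ((Fin N → ℝ) × (Fin N → ℝ))) : Prop :=
  ∀ (t : ℕ) (ht : t < N) (B : Set (Fin t → ℝ)), MeasurableSet B →
    (γ[fun z => Set.indicator B (fun _ => (1 : ℝ)) (proj N t ht.le z.2) | sigmaXfull N]
      =ᵐ[γ]
     γ[fun z => Set.indicator B (fun _ => (1 : ℝ)) (proj N t ht.le z.2) | sigmaX N t ht.le]) ∧
    (γ[fun z => Set.indicator B (fun _ => (1 : ℝ)) (proj N t ht.le z.1) | sigmaYfull N]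
      =ᵐ[γ]
     γ[fun z => Set.indicator B (fun _ => (1 : ℝ)) (proj N t ht.le z.1) | sigmaY N t ht.le])

/-- The `p`-th power cost `d(x,y)^p = ∑_t d̲(x_t,y_t)^p`. -/
def costp (N : ℕ) (p : ℝ) (dund : ℝ → ℝ → ℝ) (z : (Fin N → ℝ) × (Fin N → ℝ)) : ℝ :=
  ∑ t : Fin N, dund (z.1 t) (z.2 t) ^ p

/-- The nested distance `d_p^nd(μ,ν) = (inf_{γ ∈ Π_bc(μ,ν)} ∫ d^p dγ)^{1/p}`. -/
def nestedDist (N : ℕ) (p : ℝ) (dund : ℝ → ℝ → ℝ)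
    (μ ν : Measure (Fin N → ℝ)) : ℝ≥0∞ :=
  (⨅ γ : {γ : Measure ((Fin N → ℝ) × (Fin N → ℝ)) // γ ∈ coupling μ ν ∧ Bicausal N γ},
      ∫⁻ z, ENNReal.ofReal (costp N p dund z) ∂(γ : Measure _)) ^ (1 / p)

/-- Membership in `𝒫^p(ℝ^N)`: a probability measure with a finite `p`-th moment. -/
def MemPp (N : ℕ) (p : ℝ) (dund : ℝ → ℝ → ℝ) (μ : Measure (Fin N → ℝ)) : Prop :=
  IsProbabilityMeasure μ ∧
    ∃ x₀ : Fin N → ℝ, ∫⁻ x, ENNReal.ofReal (costp N p dund (x, x₀)) ∂μ < ⊤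

open scoped unitInterval

section Noise

variable {E : Type*} [MeasurableSpace E]

theorem measurable_finSnoc {n : ℕ} :
    Measurable (fun q : (Fin n → E) × E => (Fin.snoc q.1 q.2 : Fin (n + 1) → E)) := by
  refine measurable_pi_iff.2 fun i => ?_
  refine Fin.lastCases ?_ (fun j => ?_) i
  · simpa using measurable_snd
  · simp only [Fin.snoc_castSucc]
    fun_prop

theorem measurePreserving_finSnoc (n : ℕ) :
    MeasurePreserving (fun q : (Fin n → I) × I => (Fin.snoc q.1 q.2 : Fin (n + 1) → I)) := by
  have h := (volume_preserving_piFinSuccAbove (fun _ : Fin (n + 1) => I) (Fin.last n)).symm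
  have h' := h.comp (Measure.measurePreserving_swap (μ := (volume : Measure (Fin n → I)))
    (ν := (volume : Measure I)))
  convert h' using 1
  rotate_left
  · exact Measure.volume_eq_prod _ _
  ext q i
  simp [MeasurableEquiv.piFinSuccAbove, Fin.insertNthEquiv, Fin.insertNth_last']

theorem lintegral_finSnoc {n : ℕ} {f : (Fin (n + 1) → I) → ℝ≥0∞} (hf : Measurable f) :
    ∫⁻ u, f u = ∫⁻ v : Fin n → I, ∫⁻ w : I, f (Fin.snoc v w) := by
  rw [← (measurePreserving_finSnoc n).lintegral_comp hf, Measure.volume_eq_prod,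
    lintegral_prod _ (by
      have := measurable_finSnoc (E := I) (n := n)
      fun_prop)]

end Noise

/-- The process driven by the noise `u` through the recursion
`X (t + 1) = F t (X 1, …, X t) (u (t + 1))`. -/
def drivenPath (F : (t : ℕ) → (Fin t → ℝ) → I → ℝ) : (n : ℕ) → (Fin n → I) → Fin n → ℝ
  | 0, _ => Fin.elim0
  | n + 1, u => Fin.snoc (drivenPath F n (Fin.init u))
      (F n (drivenPath F n (Fin.init u)) (u (Fin.last n)))

section DrivenPath

variable {F G : (t : ℕ) → (Fin t → ℝ) → I → ℝ}

theorem drivenPath_snoc (F : (t : ℕ) → (Fin t → ℝ) → I → ℝ) {n : ℕ} (v : Fin n → I) (w : I) :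
    drivenPath F (n + 1) (Fin.snoc v w) =
      Fin.snoc (drivenPath F n v) (F n (drivenPath F n v) w) := by
  simp [drivenPath]

theorem drivenPath_congr {n : ℕ} (h : ∀ t < n, F t = G t) : drivenPath F n = drivenPath G n := by
  induction n with
  | zero => rfl
  | succ n ih =>
    funext u
    simp only [drivenPath, ih fun t ht => h t (by lia), h n (by lia)]

theorem measurable_drivenPath (hF : ∀ t, Measurable (Function.uncurry (F t))) (n : ℕ) :
    Measurable (drivenPath F n) := by
  induction n with
  | zero => exact measurable_of_subsingleton_codomain _
  | succ n ih =>
    have hinit : Measurable (fun u : Fin (n + 1) → I => drivenPath F n (Fin.init u)) :=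
      ih.comp (measurable_pi_iff.2 fun i => measurable_pi_apply _)
    exact measurable_finSnoc.comp (hinit.prodMk
      ((hF n).comp (hinit.prodMk (measurable_pi_apply (Fin.last n)))))

theorem measurable_proj (N t : ℕ) (ht : t ≤ N) : Measurable (proj N t ht) :=
  measurable_pi_iff.2 fun _ => measurable_pi_apply _

theorem proj_snoc {n t : ℕ} (ht : t ≤ n) (x : Fin n → ℝ) (a : ℝ) :
    proj (n + 1) t (ht.trans n.le_succ) (Fin.snoc x a) = proj n t ht x := by
  funext i
  exact Fin.snoc_castSucc (α := fun _ => ℝ) a x (Fin.castLE ht i)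

theorem exists_condProb_eq_of_measure {Ω S T : Type*} [MeasurableSpace Ω] [MeasurableSpace S]
    [MeasurableSpace T] [StandardBorelSpace T] [Nonempty T] (P : Measure Ω) [IsFiniteMeasure P]
    {X : Ω → S} {Y : Ω → T} (hX : Measurable X) (hY : Measurable Y) {B : Set T}
    (hB : MeasurableSet B) :
    ∃ h : S → ℝ≥0∞, Measurable h ∧ ∀ k : S → ℝ≥0∞, Measurable k →
      ∫⁻ ω, k (X ω) * B.indicator 1 (Y ω) ∂P = ∫⁻ ω, k (X ω) * h (X ω) ∂P := by
  set ρ := P.map (fun ω => (X ω, Y ω)) with hρ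
  have hXY : Measurable (fun ω => (X ω, Y ω)) := hX.prodMk hY
  have hfst : ρ.fst = P.map X := by
    rw [hρ, Measure.fst_map_prodMk hY]
  refine ⟨fun x => ρ.condKernel x B, ρ.condKernel.measurable_coe hB, fun k hk => ?_⟩
  have hind : Measurable (B.indicator (1 : T → ℝ≥0∞)) := measurable_one.indicator hB
  have hf : Measurable (fun q : S × T => k q.1 * B.indicator 1 q.2) :=
    (hk.comp measurable_fst).mul (hind.comp measurable_snd)
  calc ∫⁻ ω, k (X ω) * B.indicator 1 (Y ω) ∂P
      = ∫⁻ q, k q.1 * B.indicator 1 q.2 ∂ρ := by rw [hρ, lintegral_map hf hXY]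
    _ = ∫⁻ x, ∫⁻ y, k x * B.indicator 1 y ∂ρ.condKernel x ∂ρ.fst :=
        (Measure.lintegral_condKernel hf).symm
    _ = ∫⁻ x, k x * ρ.condKernel x B ∂ρ.fst := by
        refine lintegral_congr fun x => ?_
        rw [lintegral_const_mul _ hind, lintegral_indicator_one hB]
    _ = _ := by
        have hB' := ρ.condKernel.measurable_coe hB
        rw [hfst, lintegral_map (by fun_prop) hX]

/-- Two processes driven by the same noise are causal with respect to each other. -/
theorem exists_condProb_drivenPath (hF : ∀ t, Measurable (Function.uncurry (F t)))
    (hG : ∀ t, Measurable (Function.uncurry (G t))) {n t : ℕ} (ht : t ≤ n)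
    {B : Set (Fin t → ℝ)} (hB : MeasurableSet B) :
    ∃ h : (Fin t → ℝ) → ℝ≥0∞, Measurable h ∧ ∀ k : (Fin n → ℝ) → ℝ≥0∞, Measurable k →
      ∫⁻ u, k (drivenPath F n u) * B.indicator 1 (proj n t ht (drivenPath G n u)) =
        ∫⁻ u, k (drivenPath F n u) * h (proj n t ht (drivenPath F n u)) := by
  induction n, ht using Nat.le_induction with
  | base =>
    exact exists_condProb_eq_of_measure volume (measurable_drivenPath hF t)
      (measurable_drivenPath hG t) hB
  | succ n ht ih =>
    obtain ⟨h, hh, hk⟩ := ih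
    have hind : Measurable (B.indicator (1 : (Fin t → ℝ) → ℝ≥0∞)) := measurable_one.indicator hB
    refine ⟨h, hh, fun k hkm => ?_⟩
    have hstep : Measurable (fun q : (Fin n → ℝ) × I =>
        k (Fin.snoc q.1 (F n q.1 q.2))) :=
      hkm.comp (measurable_finSnoc.comp (measurable_fst.prodMk (hF n)))
    have hP := measurable_drivenPath hF (n + 1)
    have hQ := measurable_drivenPath hG (n + 1)
    have hpr := measurable_proj (n + 1) t (ht.trans n.le_succ)
    rw [lintegral_finSnoc (by fun_prop), lintegral_finSnoc (by fun_prop)]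
    simp only [drivenPath_snoc, proj_snoc ht]
    have hsec (v : Fin n → I) : Measurable (fun w : I => k (Fin.snoc (drivenPath F n v)
        (F n (drivenPath F n v) w))) :=
      hstep.comp (measurable_const.prodMk measurable_id)
    simp_rw [lintegral_mul_const _ (hsec _)]
    exact hk (fun x => ∫⁻ w, k (Fin.snoc x (F n x w))) hstep.lintegral_prod_right'

end DrivenPath

theorem condExp_indicator_comap_ae_eq {Ω S S' T : Type*} [MeasurableSpace Ω] [MeasurableSpace S]
    [MeasurableSpace S'] [MeasurableSpace T] (P : Measure Ω) [IsFiniteMeasure P]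
    {X : Ω → S} {Y : Ω → T} (hX : Measurable X) (hY : Measurable Y) {f : S → S'}
    (hf : Measurable f) {B : Set T} (hB : MeasurableSet B) {h : S' → ℝ≥0∞} (hh : Measurable h)
    (hk : ∀ k : S → ℝ≥0∞, Measurable k →
      ∫⁻ ω, k (X ω) * B.indicator 1 (Y ω) ∂P = ∫⁻ ω, k (X ω) * h (f (X ω)) ∂P) :
    P[fun ω => B.indicator (fun _ => (1 : ℝ)) (Y ω) | MeasurableSpace.comap X inferInstance]
      =ᵐ[P]
    P[fun ω => B.indicator (fun _ => (1 : ℝ)) (Y ω) |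
      MeasurableSpace.comap (fun ω => f (X ω)) inferInstance] := by
  have hhX : Measurable (fun ω => h (f (X ω))) := hh.comp (hf.comp hX)
  have hfin : ∫⁻ ω, h (f (X ω)) ∂P ≠ ∞ := by
    have h1 := hk 1 measurable_one
    simp only [Pi.one_apply, one_mul] at h1
    rw [← h1]
    refine ne_top_of_le_ne_top (measure_ne_top P Set.univ) ?_
    rw [← lintegral_one]
    exact lintegral_mono fun ω => Set.indicator_le_self' (fun _ _ => zero_le) _
  have hintegrable : Integrable (fun ω => (h (f (X ω))).toReal) P :=
    integrable_toReal_of_lintegral_ne_top hhX.aemeasurable hfin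
  have hYint : Integrable (fun ω => B.indicator (fun _ => (1 : ℝ)) (Y ω)) P :=
    ((integrable_const (1 : ℝ)).indicator (hY hB)).congr (ae_of_all _ fun ω => rfl)
  have hset : ∀ A : Set S, MeasurableSet A →
      ∫ ω in X ⁻¹' A, (h (f (X ω))).toReal ∂P =
        ∫ ω in X ⁻¹' A, B.indicator (fun _ => (1 : ℝ)) (Y ω) ∂P := by
    intro A hA
    have h1 := hk (A.indicator 1) (measurable_one.indicator hA)
    have h2 : ∀ g : Ω → ℝ≥0∞, ∫⁻ ω, A.indicator 1 (X ω) * g ω ∂P = ∫⁻ ω in X ⁻¹' A, g ω ∂P := by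
      intro g
      rw [← lintegral_indicator (hX hA)]
      refine lintegral_congr fun ω => ?_
      by_cases hω : X ω ∈ A <;> simp [hω]
    rw [h2, h2] at h1
    rw [integral_toReal hhX.aemeasurable.restrict
      (ae_restrict_of_ae (ae_lt_top hhX hfin)), ← h1,
      ← integral_toReal (f := fun ω => B.indicator 1 (Y ω))
        ((measurable_one.indicator hB).comp hY).aemeasurable
        (ae_of_all _ fun ω => by by_cases hω : Y ω ∈ B <;> simp [hω])]
    refine integral_congr_ae (ae_of_all _ fun ω => ?_)
    by_cases hω : Y ω ∈ B <;> simp [hω]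
  have hmeas : Measurable[MeasurableSpace.comap (fun ω => f (X ω)) inferInstance]
      (fun ω => (h (f (X ω))).toReal) :=
    (hh.ennreal_toReal).comp (comap_measurable _)
  have hmeas' : Measurable[MeasurableSpace.comap X inferInstance]
      (fun ω => (h (f (X ω))).toReal) :=
    (hh.ennreal_toReal.comp hf).comp (comap_measurable _)
  have e1 := ae_eq_condExp_of_forall_setIntegral_eq hX.comap_le hYint
    (g := fun ω => (h (f (X ω))).toReal)
    (fun s _ _ => hintegrable.integrableOn)
    (by rintro s ⟨A, hA, rfl⟩ -; exact hset A hA) hmeas'.stronglyMeasurable.aestronglyMeasurable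
  have e2 := ae_eq_condExp_of_forall_setIntegral_eq (hf.comp hX).comap_le hYint
    (g := fun ω => (h (f (X ω))).toReal)
    (fun s _ _ => hintegrable.integrableOn)
    (by rintro s ⟨A, hA, rfl⟩ -; exact hset _ (hf hA))
    hmeas.stronglyMeasurable.aestronglyMeasurable
  exact e1.symm.trans e2

theorem bicausal_map_drivenPath {F G : (t : ℕ) → (Fin t → ℝ) → I → ℝ}
    (hF : ∀ t, Measurable (Function.uncurry (F t)))
    (hG : ∀ t, Measurable (Function.uncurry (G t))) (N : ℕ) :
    Bicausal N ((volume : Measure (Fin N → I)).map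
      fun u => (drivenPath F N u, drivenPath G N u)) := by
  have hP := measurable_drivenPath hF N
  have hQ := measurable_drivenPath hG N
  have hPQ := hP.prodMk hQ
  set γ := (volume : Measure (Fin N → I)).map
    fun u => (drivenPath F N u, drivenPath G N u) with hγ
  have : IsProbabilityMeasure γ :=
    Measure.isProbabilityMeasure_map hPQ.aemeasurable
  intro t ht B hB
  have hind : Measurable (B.indicator (1 : (Fin t → ℝ) → ℝ≥0∞)) := measurable_one.indicator hB
  have hpr := measurable_proj N t ht.le
  constructor
  · obtain ⟨h, hh, hk⟩ := exists_condProb_drivenPath hF hG ht.le hB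
    refine condExp_indicator_comap_ae_eq γ measurable_fst (Y := fun z => proj N t ht.le z.2)
      (by fun_prop) hpr hB hh ?_
    intro k hkm
    rw [hγ, lintegral_map (by fun_prop) hPQ, lintegral_map (by fun_prop) hPQ]
    exact hk k hkm
  · obtain ⟨h, hh, hk⟩ := exists_condProb_drivenPath hG hF ht.le hB
    refine condExp_indicator_comap_ae_eq γ measurable_snd (Y := fun z => proj N t ht.le z.1)
      (by fun_prop) hpr hB hh ?_
    intro k hkm
    rw [hγ, lintegral_map (by fun_prop) hPQ, lintegral_map (by fun_prop) hPQ]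
    exact hk k hkm

/-- Every probability measure on `ℝ^n` is the law of a process driven by uniform noise. -/
theorem exists_map_drivenPath_eq (n : ℕ) (μ : Measure (Fin n → ℝ)) [IsProbabilityMeasure μ] :
    ∃ F : (t : ℕ) → (Fin t → ℝ) → I → ℝ, (∀ t, Measurable (Function.uncurry (F t))) ∧
      (volume : Measure (Fin n → I)).map (drivenPath F n) = μ := by
  induction n with
  | zero =>
    have hF : ∀ t : ℕ, Measurable (Function.uncurry (fun (_ : Fin t → ℝ) (_ : I) => (0 : ℝ))) :=
      fun t => measurable_const
    refine ⟨fun _ _ _ => 0, hF, ?_⟩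
    have : IsProbabilityMeasure ((volume : Measure (Fin 0 → I)).map
        (drivenPath (fun _ _ _ => 0) 0)) :=
      Measure.isProbabilityMeasure_map (measurable_drivenPath hF 0).aemeasurable
    ext s -
    rcases s.eq_empty_or_nonempty with rfl | hs
    · simp
    · rw [Set.Nonempty.eq_univ hs, measure_univ, measure_univ]
  | succ n ih =>
    let split : (Fin (n + 1) → ℝ) → (Fin n → ℝ) × ℝ := fun x => (Fin.init x, x (Fin.last n))
    have hsplit : Measurable split :=
      (measurable_pi_iff.2 fun i => measurable_pi_apply _).prodMk (measurable_pi_apply _)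
    set ρ := μ.map split with hρ
    have : IsProbabilityMeasure ρ := Measure.isProbabilityMeasure_map hsplit.aemeasurable
    obtain ⟨F, hF, hFμ⟩ := ih ρ.fst
    obtain ⟨f, hf, hfρ⟩ := Kernel.exists_measurable_map_eq_unitInterval ρ.condKernel
    have hF' : ∀ t, Measurable (Function.uncurry (Function.update F n f t)) := by
      intro t
      rcases eq_or_ne t n with rfl | h
      · simpa using hf
      · simpa [h] using hF t
    refine ⟨Function.update F n f, hF', ?_⟩
    have hpath : drivenPath (Function.update F n f) n = drivenPath F n :=
      drivenPath_congr fun t ht => by simp [ht.ne]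
    have hμ : μ = ρ.map (fun q => (Fin.snoc q.1 q.2 : Fin (n + 1) → ℝ)) := by
      rw [hρ, Measure.map_map measurable_finSnoc hsplit]
      convert Measure.map_id.symm using 2
      funext x
      simp [split]
    have hP := measurable_drivenPath hF' (n + 1)
    refine Measure.ext_of_lintegral _ fun k hk => ?_
    have hks : Measurable (fun q : (Fin n → ℝ) × ℝ => k (Fin.snoc q.1 q.2)) :=
      hk.comp measurable_finSnoc
    have hsec (x : Fin n → ℝ) : Measurable (fun a : ℝ => k (Fin.snoc x a)) :=
      hks.comp (measurable_const.prodMk measurable_id)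
    rw [lintegral_map hk hP, lintegral_finSnoc (by fun_prop)]
    simp only [drivenPath_snoc, hpath, Function.update_self]
    rw [hμ, lintegral_map hk measurable_finSnoc, ← Measure.lintegral_condKernel hks, ← hFμ,
      lintegral_map (hks.lintegral_kernel_prod_right' (κ := ρ.condKernel))
        (measurable_drivenPath hF n)]
    refine lintegral_congr fun v => ?_
    rw [← hfρ]
    exact (lintegral_map (hsec _) (hf.comp (measurable_const.prodMk measurable_id))).symm

/-- The `p`-th power of the metric on `ℝ`, as an extended nonnegative real. -/
def edistPow (p : ℝ) (dund : ℝ → ℝ → ℝ) (x y : ℝ) : ℝ≥0∞ := ENNReal.ofReal (dund x y ^ p)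

namespace IsCompatibleMetric

variable {dund : ℝ → ℝ → ℝ} {p : ℝ}

theorem nonneg (hd : IsCompatibleMetric dund) (x y : ℝ) : 0 ≤ dund x y := by
  have h1 := hd.triangle x y x
  rw [hd.self_eq_zero, hd.symm y x] at h1
  linarith

theorem continuous (hd : IsCompatibleMetric dund) :
    Continuous (fun q : ℝ × ℝ => dund q.1 q.2) := by
  rw [continuous_iff_seqContinuous]
  intro u a hu
  have h1 := (hd.compatible a.1 _).1 ((continuous_fst.tendsto a).comp hu)
  have h2 := (hd.compatible a.2 _).1 ((continuous_snd.tendsto a).comp hu)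
  rw [tendsto_iff_dist_tendsto_zero]
  refine squeeze_zero (fun _ => dist_nonneg) (fun n => ?_) (by simpa using h1.add h2)
  simp only [Function.comp_apply, Real.dist_eq, abs_le]
  have e1 := hd.triangle (u n).1 a.1 (u n).2
  have e2 := hd.triangle a.1 a.2 (u n).2
  have e3 := hd.triangle a.1 (u n).1 a.2
  have e4 := hd.triangle (u n).1 (u n).2 a.2
  rw [hd.symm a.2] at e2
  rw [hd.symm a.1 (u n).1] at e3
  constructor <;> linarith

theorem continuous_edistPow (hd : IsCompatibleMetric dund) (hp : 0 ≤ p) :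
    Continuous (fun q : ℝ × ℝ => edistPow p dund q.1 q.2) :=
  ENNReal.continuous_ofReal.comp (hd.continuous.rpow_const fun _ => Or.inr hp)

theorem measurable_edistPow {Ω : Type*} [MeasurableSpace Ω] (hd : IsCompatibleMetric dund)
    (hp : 0 ≤ p) {f g : Ω → ℝ} (hf : Measurable f) (hg : Measurable g) :
    Measurable (fun ω => edistPow p dund (f ω) (g ω)) :=
  (hd.continuous_edistPow hp).measurable.comp (hf.prodMk hg)

theorem edistPow_self (hd : IsCompatibleMetric dund) (hp : 0 < p) (x : ℝ) :
    edistPow p dund x x = 0 := by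
  simp [edistPow, hd.self_eq_zero, Real.zero_rpow hp.ne']

theorem edistPow_triangle (hd : IsCompatibleMetric dund) (hp : 1 ≤ p) (x y z : ℝ) :
    edistPow p dund x z ≤ 2 ^ (p - 1) * (edistPow p dund x y + edistPow p dund y z) := by
  have hp0 : 0 ≤ p := by linarith
  simp only [edistPow, ← ENNReal.ofReal_rpow_of_nonneg (hd.nonneg _ _) hp0]
  refine le_trans ?_ (ENNReal.rpow_add_le_mul_rpow_add_rpow _ _ hp)
  refine ENNReal.rpow_le_rpow ?_ hp0
  rw [← ENNReal.ofReal_add (hd.nonneg _ _) (hd.nonneg _ _)]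
  exact ENNReal.ofReal_le_ofReal (hd.triangle x y z)

theorem tendsto_of_edistPow (hd : IsCompatibleMetric dund) (hp : 0 < p) {u : ℕ → ℝ} {x : ℝ}
    (h : Tendsto (fun n => edistPow p dund x (u n)) atTop (𝓝 0)) : Tendsto u atTop (𝓝 x) := by
  rw [hd.compatible]
  have h1 := (ENNReal.tendsto_toReal ENNReal.zero_ne_top).comp h
  have h2 := h1.rpow_const (p := p⁻¹) (Or.inr (inv_nonneg.2 hp.le))
  rw [ENNReal.toReal_zero, Real.zero_rpow (inv_ne_zero hp.ne')] at h2
  refine h2.congr fun n => ?_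
  rw [Function.comp_apply, edistPow, ENNReal.toReal_ofReal (Real.rpow_nonneg (hd.nonneg _ _) _),
    Real.rpow_rpow_inv (hd.nonneg _ _) hp.ne', hd.symm]

theorem exists_edistPow_le (hd : IsCompatibleMetric dund) (hp : 0 ≤ p) (M : ℝ) :
    ∃ C : ℝ≥0, ∀ x, |x| ≤ M → edistPow p dund 0 x ≤ C := by
  have hc : Continuous (fun x : ℝ => dund 0 x ^ p) :=
    (hd.continuous.comp (continuous_const.prodMk continuous_id)).rpow_const fun _ => Or.inr hp
  obtain ⟨C, hC⟩ := (isCompact_Icc (a := -M) (b := M)).bddAbove_image hc.continuousOn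
  exact ⟨C.toNNReal, fun x hx =>
    ENNReal.ofReal_le_ofReal (hC ⟨x, abs_le.1 hx, rfl⟩)⟩

end IsCompatibleMetric

theorem ae_tendsto_zero_of_tsum_lintegral_ne_top {Ω : Type*} [MeasurableSpace Ω] {P : Measure Ω}
    {f : ℕ → Ω → ℝ≥0∞} (hf : ∀ k, AEMeasurable (f k) P) (h : ∑' k, ∫⁻ ω, f k ω ∂P ≠ ∞) :
    ∀ᵐ ω ∂P, Tendsto (fun k => f k ω) atTop (𝓝 0) := by
  rw [← lintegral_tsum hf] at h
  filter_upwards [ae_lt_top' (AEMeasurable.tsum hf) h] with ω hω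
  exact ENNReal.tendsto_atTop_zero_of_tsum_ne_top hω.ne

theorem ae_tendsto_zero_of_lintegral_le_geometric {Ω : Type*} [MeasurableSpace Ω] {P : Measure Ω}
    {f : ℕ → Ω → ℝ≥0∞} (hf : ∀ k, AEMeasurable (f k) P)
    (h : ∀ k, ∫⁻ ω, f k ω ∂P ≤ 2⁻¹ ^ k) :
    ∀ᵐ ω ∂P, Tendsto (fun k => f k ω) atTop (𝓝 0) := by
  refine ae_tendsto_zero_of_tsum_lintegral_ne_top hf
    (ne_top_of_le_ne_top ?_ (ENNReal.tsum_le_tsum h))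
  rw [ENNReal.tsum_geometric]
  simp

theorem tendsto_lintegral_edistPow {Ω : Type*} [MeasurableSpace Ω] {P : Measure Ω}
    [IsFiniteMeasure P] {dund : ℝ → ℝ → ℝ} (hd : IsCompatibleMetric dund) {p : ℝ} (hp : 1 ≤ p)
    {f : Ω → ℝ} (hf : Measurable f) (hf0 : ∫⁻ ω, edistPow p dund (f ω) 0 ∂P ≠ ∞)
    {φ : ℕ → Ω → ℝ} {ψ : Ω → ℝ} (hφ : ∀ k, Measurable (φ k)) {M : ℝ} (hM : ∀ k ω, |φ k ω| ≤ M)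
    (hlim : ∀ᵐ ω ∂P, Tendsto (fun k => φ k ω) atTop (𝓝 (ψ ω))) :
    Tendsto (fun k => ∫⁻ ω, edistPow p dund (f ω) (φ k ω) ∂P) atTop
      (𝓝 (∫⁻ ω, edistPow p dund (f ω) (ψ ω) ∂P)) := by
  have hp0 : 0 ≤ p := by linarith
  obtain ⟨C, hC⟩ := hd.exists_edistPow_le hp0 M
  have hcont := hd.continuous_edistPow hp0
  refine tendsto_lintegral_of_dominated_convergence
    (fun ω => 2 ^ (p - 1) * (edistPow p dund (f ω) 0 + C)) (fun k => ?_) (fun k => ?_) ?_ ?_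
  · exact hd.measurable_edistPow hp0 hf (hφ k)
  · refine ae_of_all _ fun ω => (hd.edistPow_triangle hp _ 0 _).trans ?_
    exact mul_le_mul' le_rfl (add_le_add le_rfl (hC _ (hM k ω)))
  · have h2 : (2 : ℝ≥0∞) ^ (p - 1) ≠ ∞ := by
      refine ENNReal.rpow_ne_top_of_nonneg (by linarith) (by simp)
    rw [lintegral_const_mul' _ _ h2, lintegral_add_right _ measurable_const, lintegral_const]
    refine ENNReal.mul_ne_top h2 (ENNReal.add_ne_top.2 ⟨hf0, ?_⟩)
    exact ENNReal.mul_ne_top ENNReal.coe_ne_top (measure_ne_top _ _)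
  · filter_upwards [hlim] with ω hω
    have hslice : Continuous (fun y => edistPow p dund (f ω) y) :=
      hcont.comp (continuous_const.prodMk continuous_id)
    exact (hslice.tendsto (ψ ω)).comp hω

/-- Truncation of a real number to the interval `[-M, M]`. -/
def clip (M : ℕ) (x : ℝ) : ℝ := max (-M) (min M x)

theorem continuous_clip (M : ℕ) : Continuous (clip M) := by
  unfold clip
  fun_prop

theorem abs_clip_le (M : ℕ) (x : ℝ) : |clip M x| ≤ M := by
  have hM : (0 : ℝ) ≤ M := M.cast_nonneg
  rw [abs_le, clip]
  exact ⟨le_max_left _ _, max_le (by linarith) (min_le_left _ _)⟩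

theorem clip_eq_self {M : ℕ} {x : ℝ} (h : |x| ≤ M) : clip M x = x := by
  rw [abs_le] at h
  rw [clip, min_eq_right h.2, max_eq_right h.1]

/-- Truncations of a fixed dense sequence of continuous functions are dense for the cost
`edistPow`, whatever the underlying finite measure. -/
theorem exists_clip_denseSeq_lintegral_lt {S : Type*} [TopologicalSpace S] [MeasurableSpace S]
    [BorelSpace S] [SecondCountableTopology S] [LocallyCompactSpace S]
    [TopologicalSpace.PseudoMetrizableSpace S] (m : Measure S)
    [IsFiniteMeasure m] {dund : ℝ → ℝ → ℝ} (hd : IsCompatibleMetric dund) {p : ℝ} (hp : 1 ≤ p)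
    {f : S → ℝ} (hf : Measurable f) (hf0 : ∫⁻ x, edistPow p dund (f x) 0 ∂m ≠ ∞) {ε : ℝ≥0∞}
    (hε : 0 < ε) :
    ∃ M k : ℕ, ∫⁻ x, edistPow p dund (f x)
      (clip M (TopologicalSpace.denseSeq C(S, ℝ) k x)) ∂m < ε := by
  have hp0 : 0 < p := by linarith
  let trunc : ℕ → S → ℝ := fun M => {x | |f x| ≤ M}.indicator f
  have hset (M : ℕ) : MeasurableSet {x | |f x| ≤ M} :=
    measurableSet_le (by fun_prop) measurable_const
  have htrunc_meas (M : ℕ) : Measurable (trunc M) := hf.indicator (hset M)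
  have htrunc_le (M : ℕ) (x : S) : |trunc M x| ≤ M := by
    by_cases h : |f x| ≤ M <;> simp [trunc, h]
  obtain ⟨M, hM⟩ : ∃ M, ∫⁻ x, edistPow p dund (f x) (trunc M x) ∂m < ε := by
    have hlim : Tendsto (fun M => ∫⁻ x, edistPow p dund (f x) (trunc M x) ∂m) atTop
        (𝓝 (∫⁻ _, 0 ∂m)) := by
      refine tendsto_lintegral_of_dominated_convergence (fun x => edistPow p dund (f x) 0)
        (fun M => hd.measurable_edistPow hp0.le hf (htrunc_meas M))
        (fun M => ae_of_all _ fun x => ?_) hf0 (ae_of_all _ fun x => ?_)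
      · by_cases h : |f x| ≤ M
        · simp [trunc, h, hd.edistPow_self hp0]
        · simp [trunc, h]
      · refine tendsto_const_nhds.congr' ?_
        filter_upwards [eventually_ge_atTop ⌈|f x|⌉₊] with M hM
        have h : |f x| ≤ M := Nat.ceil_le.1 hM
        simp [trunc, h, hd.edistPow_self hp0]
    rw [lintegral_zero] at hlim
    exact (hlim.eventually_lt_const hε).exists
  obtain ⟨g, hg⟩ : ∃ g : C(S, ℝ), ∫⁻ x, edistPow p dund (f x) (clip M (g x)) ∂m < ε := by
    have hintegrable : Integrable (trunc M) m :=
      Integrable.of_bound (htrunc_meas M).aestronglyMeasurable M (ae_of_all _ (htrunc_le M))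
    have happrox (k : ℕ) := hintegrable.exists_boundedContinuous_lintegral_sub_le
      (ε := 2⁻¹ ^ k) (pow_ne_zero _ (by simp))
    choose g hg _ using happrox
    have hae := ae_tendsto_zero_of_lintegral_le_geometric (fun k =>
      ((htrunc_meas M).sub (g k).continuous.measurable).enorm.aemeasurable) hg
    have hlim := tendsto_lintegral_edistPow hd hp hf hf0 (φ := fun k x => clip M (g k x))
      (ψ := trunc M) (fun k => ((continuous_clip M).comp (g k).continuous).measurable)
      (fun k x => abs_clip_le M _) (by
        filter_upwards [hae] with x hx
        rw [← clip_eq_self (htrunc_le M x)]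
        refine ((continuous_clip M).tendsto _).comp ?_
        rw [tendsto_iff_edist_tendsto_0]
        simpa only [edist_comm _ (trunc M x), edist_eq_enorm_sub, Pi.sub_apply] using hx)
    obtain ⟨k, hk⟩ := (hlim.eventually_lt_const hM).exists
    exact ⟨(g k).toContinuousMap, hk⟩
  obtain ⟨u, hu, hulim⟩ := mem_closure_iff_seq_limit.1
    (TopologicalSpace.denseRange_denseSeq C(S, ℝ) g)
  have hlim := tendsto_lintegral_edistPow hd hp hf hf0 (φ := fun k x => clip M (u k x))
    (ψ := fun x => clip M (g x)) (fun k => ((continuous_clip M).comp (u k).continuous).measurable)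
    (fun k x => abs_clip_le M _) (ae_of_all _ fun x => ((continuous_clip M).tendsto _).comp
      (((continuous_eval_const x).tendsto g).comp hulim))
  obtain ⟨k, hk⟩ := (hlim.eventually_lt_const hg).exists
  obtain ⟨j, hj⟩ := hu k
  exact ⟨M, j, by rwa [hj]⟩

/-- A countable family of continuous recursions, indexed by codes. -/
def codedRecursion (e : ℕ → ℕ × ℕ) (t : ℕ) (x : Fin t → ℝ) (w : I) : ℝ :=
  clip (e t).1 (TopologicalSpace.denseSeq C((Fin t → ℝ) × I, ℝ) (e t).2 (x, w))

theorem continuous_codedRecursion (e : ℕ → ℕ × ℕ) (t : ℕ) :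
    Continuous (Function.uncurry (codedRecursion e t)) :=
  (continuous_clip _).comp (ContinuousMap.continuous _)

theorem abs_drivenPath_codedRecursion_le (e : ℕ → ℕ × ℕ) (n : ℕ) (u : Fin n → I) (i : Fin n) :
    |drivenPath (codedRecursion e) n u i| ≤ (e i).1 := by
  induction n with
  | zero => exact i.elim0
  | succ n ih =>
    refine Fin.lastCases ?_ (fun j => ?_) i
    · simpa [drivenPath, codedRecursion] using abs_clip_le _ _
    · simpa [drivenPath] using ih (Fin.init u) j

theorem drivenPath_zero (n : ℕ) (u : Fin n → I) (i : Fin n) :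
    drivenPath (fun _ _ _ => 0) n u i = 0 := by
  induction n with
  | zero => exact i.elim0
  | succ n ih =>
    refine Fin.lastCases ?_ (fun j => ?_) i
    · simp [drivenPath]
    · simpa [drivenPath] using ih (Fin.init u) j

/-- A process driven by uniform noise, with finite moments, is approximated in cost by processes
driven by the same noise through coded recursions. -/
theorem exists_codedRecursion_lintegral_lt {dund : ℝ → ℝ → ℝ} (hd : IsCompatibleMetric dund)
    {p : ℝ} (hp : 1 ≤ p) {F : (t : ℕ) → (Fin t → ℝ) → I → ℝ}
    (hF : ∀ t, Measurable (Function.uncurry (F t))) (n : ℕ)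
    (hmom : ∫⁻ u, ∑ i, edistPow p dund (drivenPath F n u i) 0 ≠ ∞) {ε : ℝ≥0∞} (hε : 0 < ε) :
    ∃ e : ℕ → ℕ × ℕ, ∫⁻ u, ∑ i, edistPow p dund (drivenPath F n u i)
      (drivenPath (codedRecursion e) n u i) < ε := by
  have hp0 : 0 < p := by linarith
  have hGm (e : ℕ → ℕ × ℕ) (t : ℕ) : Measurable (Function.uncurry (codedRecursion e t)) :=
    (continuous_codedRecursion e t).measurable
  have hcost_meas {n : ℕ} {x y : (Fin n → I) → Fin n → ℝ} (hx : Measurable x)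
      (hy : Measurable y) : Measurable (fun u => ∑ i, edistPow p dund (x u i) (y u i)) :=
    Finset.measurable_sum _ fun i _ => hd.measurable_edistPow hp0.le
      ((measurable_pi_apply i).comp hx) ((measurable_pi_apply i).comp hy)
  induction n generalizing ε with
  | zero => exact ⟨fun _ => 0, by simpa using hε⟩
  | succ n ih =>
    have hP := measurable_drivenPath hF n
    have hsplit {G : (t : ℕ) → (Fin t → ℝ) → I → ℝ}
        (hG : ∀ t, Measurable (Function.uncurry (G t))) :
        ∫⁻ u, ∑ i, edistPow p dund (drivenPath F (n + 1) u i) (drivenPath G (n + 1) u i) =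
          (∫⁻ v, ∑ i, edistPow p dund (drivenPath F n v i) (drivenPath G n v i)) +
          ∫⁻ q : (Fin n → I) × I, edistPow p dund (F n (drivenPath F n q.1) q.2)
            (G n (drivenPath G n q.1) q.2) := by
      have hQ := measurable_drivenPath hG n
      have hlast : Measurable (fun q : (Fin n → I) × I =>
          edistPow p dund (F n (drivenPath F n q.1) q.2) (G n (drivenPath G n q.1) q.2)) :=
        hd.measurable_edistPow hp0.le
          ((hF n).comp ((hP.comp measurable_fst).prodMk measurable_snd))
          ((hG n).comp ((hQ.comp measurable_fst).prodMk measurable_snd))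
      rw [lintegral_finSnoc (hcost_meas (measurable_drivenPath hF _) (measurable_drivenPath hG _)),
        Measure.volume_eq_prod, lintegral_prod _ hlast.aemeasurable,
        ← lintegral_add_left (hcost_meas hP hQ)]
      refine lintegral_congr fun v => ?_
      simp only [drivenPath_snoc, Fin.sum_univ_castSucc, Fin.snoc_castSucc, Fin.snoc_last]
      rw [lintegral_add_left measurable_const, lintegral_const, measure_univ, mul_one]
    have hmom_split := hsplit (G := fun _ _ _ => 0) (fun _ => measurable_const)
    simp only [drivenPath_zero] at hmom_split
    rw [hmom_split, ENNReal.add_ne_top] at hmom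
    obtain ⟨hmom_init, hmom_last⟩ := hmom
    have hpair : Measurable (fun q : (Fin n → I) × I => (drivenPath F n q.1, q.2)) :=
      (hP.comp measurable_fst).prodMk measurable_snd
    have hX : Measurable (fun q : (Fin n → I) × I => F n (drivenPath F n q.1) q.2) :=
      (hF n).comp hpair
    have hε2 : 0 < ε / 2 := ENNReal.half_pos hε.ne'
    obtain ⟨M, j, hMj⟩ := exists_clip_denseSeq_lintegral_lt
      ((volume : Measure ((Fin n → I) × I)).map fun q => (drivenPath F n q.1, q.2)) hd hp (hF n)
      (by
        rw [lintegral_map (hd.measurable_edistPow hp0.le (hF n) measurable_const) hpair]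
        exact hmom_last) hε2
    set g : C((Fin n → ℝ) × I, ℝ) := TopologicalSpace.denseSeq C((Fin n → ℝ) × I, ℝ) j
    have hgc : Continuous (fun q : (Fin n → ℝ) × I => clip M (g q)) :=
      (continuous_clip M).comp g.continuous
    rw [lintegral_map (hd.measurable_edistPow hp0.le (hF n) hgc.measurable) hpair] at hMj
    choose e he using fun k : ℕ => ih hmom_init (ε := 2⁻¹ ^ k) (ENNReal.pow_pos (by simp) k)
    have hQ (k : ℕ) := measurable_drivenPath (hGm (e k)) n
    have hae := ae_tendsto_zero_of_lintegral_le_geometric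
      (fun k => (hcost_meas hP (hQ k)).aemeasurable) fun k => (he k).le
    have hpath : ∀ᵐ v : Fin n → I,
        Tendsto (fun k => drivenPath (codedRecursion (e k)) n v) atTop (𝓝 (drivenPath F n v)) := by
      filter_upwards [hae] with v hv
      refine tendsto_pi_nhds.2 fun i => hd.tendsto_of_edistPow hp0 ?_
      exact tendsto_of_tendsto_of_tendsto_of_le_of_le tendsto_const_nhds hv (fun _ => zero_le)
        fun k => Finset.single_le_sum (f := fun i => edistPow p dund (drivenPath F n v i)
          (drivenPath (codedRecursion (e k)) n v i)) (fun _ _ => zero_le) (Finset.mem_univ i)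
    have hlim := tendsto_lintegral_edistPow (P := (volume : Measure ((Fin n → I) × I))) hd hp hX
      hmom_last
      (φ := fun k q => clip M (g (drivenPath (codedRecursion (e k)) n q.1, q.2)))
      (ψ := fun q => clip M (g (drivenPath F n q.1, q.2)))
      (fun k => hgc.measurable.comp (((hQ k).comp measurable_fst).prodMk measurable_snd))
      (fun k q => abs_clip_le M _) (by
        rw [Measure.volume_eq_prod]
        filter_upwards [Measure.quasiMeasurePreserving_fst.ae hpath] with q hq
        have h := hq.prodMk_nhds (tendsto_const_nhds (x := q.2))
        exact (hgc.tendsto _).comp h)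
    have hgeom : Tendsto (fun k : ℕ => (2⁻¹ : ℝ≥0∞) ^ k) atTop (𝓝 0) :=
      ENNReal.tendsto_pow_atTop_nhds_zero_of_lt_one (by simp)
    obtain ⟨k, hk1, hk2⟩ :=
      ((hlim.eventually_lt_const hMj).and (hgeom.eventually_lt_const hε2)).exists
    refine ⟨Function.update (e k) n (M, j), ?_⟩
    have hcongr : drivenPath (codedRecursion (Function.update (e k) n (M, j))) n =
        drivenPath (codedRecursion (e k)) n :=
      drivenPath_congr fun t ht => by
        funext x w
        simp [codedRecursion, ht.ne]
    rw [hsplit (hGm _), hcongr, ← ENNReal.add_halves ε]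
    refine ENNReal.add_lt_add ((he k).trans hk2) ?_
    simpa [codedRecursion] using hk1

/-- for every `N ≥ 1` and `p ∈ [1,∞)`, `(𝒫^p(ℝ^N), d_p^nd)` is separable:
there is a countable subset of `𝒫^p(ℝ^N)` that is dense for the nested distance. -/
theorem nestedDist_separable (N : ℕ) (hN : 1 ≤ N) (p : ℝ) (hp : 1 ≤ p)
    (dund : ℝ → ℝ → ℝ) (hd : IsCompatibleMetric dund) :
    ∃ D : Set (Measure (Fin N → ℝ)), D.Countable ∧
      (∀ ν ∈ D, MemPp N p dund ν) ∧
      ∀ μ : Measure (Fin N → ℝ), MemPp N p dund μ →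
        ∀ ε : ℝ≥0∞, 0 < ε → ∃ ν ∈ D, nestedDist N p dund μ ν < ε := by
  have hp0 : 0 < p := by linarith
  have hcost (x y : Fin N → ℝ) : ENNReal.ofReal (costp N p dund (x, y)) =
      ∑ i, edistPow p dund (x i) (y i) :=
    ENNReal.ofReal_sum_of_nonneg fun i _ => Real.rpow_nonneg (hd.nonneg _ _) _
  have hcost_meas : Measurable (fun z : (Fin N → ℝ) × (Fin N → ℝ) =>
      ENNReal.ofReal (costp N p dund z)) := by
    rw [show (fun z : (Fin N → ℝ) × (Fin N → ℝ) => ENNReal.ofReal (costp N p dund z)) =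
      fun z => ∑ i, edistPow p dund (z.1 i) (z.2 i) from funext fun z => hcost z.1 z.2]
    exact Finset.measurable_sum _ fun i _ => hd.measurable_edistPow hp0.le
      (by fun_prop) (by fun_prop)
  have hcost_meas_left (y : Fin N → ℝ) : Measurable (fun x : Fin N → ℝ =>
      ENNReal.ofReal (costp N p dund (x, y))) :=
    hcost_meas.comp (measurable_id.prodMk measurable_const)
  have hGm (e : ℕ → ℕ × ℕ) (t : ℕ) : Measurable (Function.uncurry (codedRecursion e t)) :=
    (continuous_codedRecursion e t).measurable
  let extend : (Fin N → ℕ × ℕ) → ℕ → ℕ × ℕ := fun e t => if h : t < N then e ⟨t, h⟩ else 0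
  let law : (Fin N → ℕ × ℕ) → Measure (Fin N → ℝ) := fun e =>
    (volume : Measure (Fin N → I)).map (drivenPath (codedRecursion (extend e)) N)
  refine ⟨Set.range law, Set.countable_range law, ?_, ?_⟩
  · rintro _ ⟨e, rfl⟩
    have hQ := measurable_drivenPath (hGm (extend e)) N
    refine ⟨Measure.isProbabilityMeasure_map hQ.aemeasurable, 0, ?_⟩
    choose C hC using fun i : Fin N => hd.exists_edistPow_le hp0.le ((extend e i).1 : ℝ)
    rw [lintegral_map (hcost_meas_left 0) hQ]
    refine (lintegral_mono (g := fun _ => ∑ i, (C i : ℝ≥0∞)) fun u => ?_).trans_lt ?_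
    · rw [hcost]
      refine Finset.sum_le_sum fun i _ => ?_
      rw [edistPow, hd.symm]
      exact hC i _ (abs_drivenPath_codedRecursion_le _ _ _ _)
    · rw [lintegral_const, measure_univ, mul_one]
      exact ENNReal.sum_lt_top.2 fun i _ => ENNReal.coe_lt_top
  · rintro μ ⟨hμ, x₀, hx₀⟩ ε hε
    obtain ⟨F, hF, hFμ⟩ := exists_map_drivenPath_eq N μ
    have hP := measurable_drivenPath hF N
    rw [← hFμ, lintegral_map (hcost_meas_left x₀) hP] at hx₀
    have hmom : ∫⁻ u, ∑ i, edistPow p dund (drivenPath F N u i) 0 ≠ ∞ := by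
      have h2 : (2 : ℝ≥0∞) ^ (p - 1) ≠ ∞ :=
        ENNReal.rpow_ne_top_of_nonneg (by linarith) (by simp)
      refine ne_top_of_le_ne_top ?_ (lintegral_mono
        (g := fun u => 2 ^ (p - 1) * (ENNReal.ofReal (costp N p dund (drivenPath F N u, x₀)) +
          ENNReal.ofReal (costp N p dund (x₀, 0)))) fun u => ?_)
      · rw [lintegral_const_mul' _ _ h2, lintegral_add_right _ measurable_const, lintegral_const,
          measure_univ, mul_one]
        exact ENNReal.mul_ne_top h2 (ENNReal.add_ne_top.2 ⟨hx₀.ne, ENNReal.ofReal_ne_top⟩)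
      · simp only [hcost]
        rw [← Finset.sum_add_distrib, Finset.mul_sum]
        exact Finset.sum_le_sum fun i _ => hd.edistPow_triangle hp _ _ _
    obtain ⟨e, he⟩ := exists_codedRecursion_lintegral_lt hd hp hF N hmom
      (ENNReal.rpow_pos_of_nonneg hε hp0.le)
    have hextend : drivenPath (codedRecursion (extend fun i => e i)) N =
        drivenPath (codedRecursion e) N :=
      drivenPath_congr fun t ht => by
        funext x w
        simp [codedRecursion, extend, ht]
    have hQ := measurable_drivenPath (hGm e) N
    refine ⟨law fun i => e i, ⟨fun i => e i, rfl⟩, ?_⟩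
    have hγ : (volume : Measure (Fin N → I)).map
        (fun u => (drivenPath F N u, drivenPath (codedRecursion e) N u)) ∈
        coupling μ (law fun i => e i) := by
      constructor
      · rw [Measure.map_map measurable_fst (hP.prodMk hQ)]
        exact hFμ
      · rw [Measure.map_map measurable_snd (hP.prodMk hQ)]
        simp only [law, hextend]
        rfl
    have hlt : (⨅ γ : {γ : Measure ((Fin N → ℝ) × (Fin N → ℝ)) //
        γ ∈ coupling μ (law fun i => e i) ∧ Bicausal N γ},
        ∫⁻ z, ENNReal.ofReal (costp N p dund z) ∂(γ : Measure _)) < ε ^ p := by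
      refine (iInf_le _ ⟨_, hγ, bicausal_map_drivenPath hF (hGm e) N⟩).trans_lt ?_
      rw [lintegral_map hcost_meas (hP.prodMk hQ)]
      simpa only [hcost] using he
    rw [nestedDist, one_div, ← ENNReal.rpow_rpow_inv hp0.ne' ε]
    exact ENNReal.rpow_lt_rpow hlt (inv_pos.2 hp0)
end
end

section
/- Let X₁, X₂, Y₁, Y₂ be Polish spaces with their Borel σ-algebras, let f : X₁ → X₂ and g : Y₁ → Y₂ be Borel maps, let α, β be Borel probability measures on X₁, Y₁ respectively, and set μ' := (id,f)_*α on X₁ × X₂ and ν' := (id,g)_*β on Y₁ × Y₂. Then every coupling Γ ∈ Π(μ',ν') is the pushforward of its ((x₁,y₁))-marginal γ̄ ∈ Π(α,β) under the map (x₁,y₁) ↦ ((x₁,f(x₁)),(y₁,g(y₁))); in particular, Γ-almost surely x₂ = f(x₁) and y₂ = g(y₁). -/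
open MeasureTheory

noncomputable section

/-- If the marginal of `Γ` under `p` is carried by the graph of `f`, then `Γ`-almost every point is
mapped by `p` into the graph of `f`. -/
theorem ae_snd_eq_of_map_eq_map_graph {Z X Y : Type*} [MeasurableSpace Z] [MeasurableSpace X]
    [MeasurableSpace Y] [MeasurableEq Y] {Γ : Measure Z} {p : Z → X × Y} (hp : Measurable p)
    {f : X → Y} (hf : Measurable f) {α : Measure X} (h : Γ.map p = α.map (fun x => (x, f x))) :
    ∀ᵐ z ∂Γ, (p z).2 = f (p z).1 := by
  have hgraph : MeasurableSet {w : X × Y | w.2 = f w.1} :=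
    measurableSet_eq_fun measurable_snd (hf.comp measurable_fst)
  have hae : ∀ᵐ w ∂(Γ.map p), w.2 = f w.1 := by
    rw [h, ae_map_iff (by fun_prop) hgraph]
    exact Filter.Eventually.of_forall fun _ => rfl
  exact ae_of_ae_map hp.aemeasurable hae

/-- The first marginal of a graph measure is the base measure. -/
theorem map_fst_map_graph {X Y : Type*} [MeasurableSpace X] [MeasurableSpace Y]
    {f : X → Y} (hf : Measurable f) (α : Measure X) :
    (α.map (fun x => (x, f x))).map Prod.fst = α := by
  rw [Measure.map_map measurable_fst (by fun_prop)]
  exact Measure.map_id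

/-- if `μ' = (id,f)_*α` and `ν' = (id,g)_*β` for Borel maps `f, g` on Polish
spaces, then every coupling `Γ ∈ Π(μ',ν')` is the pushforward of its `(x₁,y₁)`-marginal
`γ̄ ∈ Π(α,β)` under `(x₁,y₁) ↦ ((x₁,f(x₁)),(y₁,g(y₁)))`; in particular `Γ`-a.s.
`x₂ = f(x₁)` and `y₂ = g(y₁)`. -/
theorem coupling_of_graph_measures
    {X₁ X₂ Y₁ Y₂ : Type*}
    [TopologicalSpace X₁] [PolishSpace X₁] [MeasurableSpace X₁] [BorelSpace X₁]
    [TopologicalSpace X₂] [PolishSpace X₂] [MeasurableSpace X₂] [BorelSpace X₂]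
    [TopologicalSpace Y₁] [PolishSpace Y₁] [MeasurableSpace Y₁] [BorelSpace Y₁]
    [TopologicalSpace Y₂] [PolishSpace Y₂] [MeasurableSpace Y₂] [BorelSpace Y₂]
    (f : X₁ → X₂) (g : Y₁ → Y₂) (hf : Measurable f) (hg : Measurable g)
    (α : Measure X₁) (β : Measure Y₁)
    [IsProbabilityMeasure α] [IsProbabilityMeasure β]
    (Γ : Measure ((X₁ × X₂) × (Y₁ × Y₂)))
    (hΓ : Γ ∈ coupling (α.map (fun x => (x, f x))) (β.map (fun y => (y, g y)))) :
    (Γ.map (fun z => (z.1.1, z.2.1))) ∈ coupling α β ∧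
    Γ = (Γ.map (fun z => (z.1.1, z.2.1))).map
        (fun q : X₁ × Y₁ => ((q.1, f q.1), (q.2, g q.2))) ∧
    ∀ᵐ z ∂Γ, z.1.2 = f z.1.1 ∧ z.2.2 = g z.2.1 := by
  obtain ⟨h₁, h₂⟩ := hΓ
  have hae : ∀ᵐ z ∂Γ, z.1.2 = f z.1.1 ∧ z.2.2 = g z.2.1 :=
    (ae_snd_eq_of_map_eq_map_graph measurable_fst hf h₁).and
      (ae_snd_eq_of_map_eq_map_graph measurable_snd hg h₂)
  refine ⟨⟨?_, ?_⟩, ?_, hae⟩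
  · rw [← map_fst_map_graph hf α, ← h₁, Measure.map_map (by fun_prop) (by fun_prop),
      Measure.map_map (by fun_prop) (by fun_prop)]
    rfl
  · rw [← map_fst_map_graph hg β, ← h₂, Measure.map_map (by fun_prop) (by fun_prop),
      Measure.map_map (by fun_prop) (by fun_prop)]
    rfl
  · rw [Measure.map_map (by fun_prop) (by fun_prop)]
    conv_lhs => rw [← Measure.map_id (μ := Γ)]
    refine Measure.map_congr ?_
    filter_upwards [hae] with z hz
    exact Prod.ext (Prod.ext rfl hz.1) (Prod.ext rfl hz.2)
end
end

section
/- Let X and Y be Polish spaces. The set S := { m ∈ 𝒫(X × Y) : m(Graph(f)) = 1 for some Borel f : X → Y } is a Gδ subset of 𝒫(X × Y) equipped with the topology of weak convergence, i.e., S is a countable intersection of weakly open subsets of 𝒫(X × Y). -/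
open MeasureTheory Filter Topology
open scoped BoundedContinuousFunction

/-- The bounded continuous function `(x, y) ↦ ‖g y - h x‖` on a product space. -/
def normSubProd {X Y : Type*} [TopologicalSpace X] [TopologicalSpace Y]
    (g : Y →ᵇ ℝ) (h : X →ᵇ ℝ) : X × Y →ᵇ ℝ :=
  (g.compContinuous ⟨Prod.snd, continuous_snd⟩ -
    h.compContinuous ⟨Prod.fst, continuous_fst⟩).normComp

lemma normSubProd_apply {X Y : Type*} [TopologicalSpace X] [TopologicalSpace Y]
    (g : Y →ᵇ ℝ) (h : X →ᵇ ℝ) (z : X × Y) : normSubProd g h z = ‖g z.2 - h z.1‖ := rfl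

lemma normSubProd_nonneg {X Y : Type*} [TopologicalSpace X] [TopologicalSpace Y]
    (g : Y →ᵇ ℝ) (h : X →ᵇ ℝ) (z : X × Y) : 0 ≤ normSubProd g h z :=
  norm_nonneg (g z.2 - h z.1)

/-- Countably many bounded continuous real functions separate the points of a Polish space. -/
lemma exists_seq_boundedContinuous_injective (Y : Type*) [TopologicalSpace Y] [PolishSpace Y] :
    ∃ g : ℕ → Y →ᵇ ℝ, Function.Injective fun y k => g k y := by
  let _ := TopologicalSpace.upgradeIsCompletelyMetrizable Y
  obtain ⟨F, hF⟩ := Metric.PiNatEmbed.exists_embedding_to_hilbert_cube (X := Y)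
  refine ⟨fun k => BoundedContinuousFunction.ofNormedAddCommGroup (fun y => (F y k : ℝ))
    (continuous_subtype_val.comp ((continuous_apply k).comp hF.continuous)) 1
    fun y => ?_, fun y y' h => hF.injective (funext fun k => Subtype.ext (congrFun h k))⟩
  rw [Real.norm_of_nonneg (F y k).2.1]
  exact (F y k).2.2

/-- If `g y` is almost surely a measurable function of `x`, then it is approximated in `L¹` by
bounded continuous functions of `x`. -/
lemma exists_integral_normSubProd_lt {X Y : Type*}
    [TopologicalSpace X] [PolishSpace X] [MeasurableSpace X] [BorelSpace X]
    [TopologicalSpace Y] [MeasurableSpace Y] [BorelSpace Y]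
    (m : Measure (X × Y)) [IsFiniteMeasure m] (g : Y →ᵇ ℝ)
    {f : X → Y} (hf : Measurable f) (hm : ∀ᵐ z ∂m, z.2 = f z.1) {ε : ℝ} (hε : 0 < ε) :
    ∃ h : X →ᵇ ℝ, ∫ z, normSubProd g h z ∂m < ε := by
  let _ := TopologicalSpace.upgradeIsCompletelyMetrizable X
  have hgf : Measurable fun x => g (f x) := g.continuous.measurable.comp hf
  have hint : Integrable (fun x => g (f x)) (m.map Prod.fst) :=
    .of_bound hgf.aestronglyMeasurable ‖g‖ (.of_forall fun x => g.norm_coe_le_norm _)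
  obtain ⟨h, hh, -⟩ := hint.exists_boundedContinuous_integral_sub_le (half_pos hε)
  refine ⟨h, lt_of_le_of_lt ?_ (half_lt_self hε)⟩
  have hmeas : Measurable fun x => ‖g (f x) - h x‖ := (hgf.sub h.continuous.measurable).norm
  rw [integral_map measurable_fst.aemeasurable hmeas.aestronglyMeasurable] at hh
  refine le_of_eq_of_le (integral_congr_ae ?_) hh
  filter_upwards [hm] with z hz
  rw [normSubProd_apply, hz]

/-- If `g y` is approximated in `L¹` by bounded continuous functions of `x`, then it is almost
surely a measurable function of `x`. -/
lemma exists_measurable_ae_eq_of_integral_normSubProd_lt {X Y : Type*}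
    [TopologicalSpace X] [MeasurableSpace X] [BorelSpace X]
    [TopologicalSpace Y] [PolishSpace Y] [MeasurableSpace Y] [BorelSpace Y]
    (m : Measure (X × Y)) [IsFiniteMeasure m] (g : Y →ᵇ ℝ)
    (H : ∀ n : ℕ, ∃ h : X →ᵇ ℝ, ∫ z, normSubProd g h z ∂m < 1 / ((n : ℝ) + 1)) :
    ∃ G : X → ℝ, Measurable G ∧ ∀ᵐ z ∂m, G z.1 = g z.2 := by
  choose h hh using H
  have hmeas : ∀ n, AEStronglyMeasurable (fun z : X × Y => h n z.1) m := fun n =>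
    ((h n).continuous.measurable.comp measurable_fst).aestronglyMeasurable
  have hgmeas : AEStronglyMeasurable (fun z : X × Y => g z.2) m :=
    (g.continuous.measurable.comp measurable_snd).aestronglyMeasurable
  have hlim : Tendsto (fun n => eLpNorm ((fun z : X × Y => h n z.1) - fun z => g z.2) 1 m)
      atTop (𝓝 0) := by
    have heq : ∀ n, eLpNorm ((fun z : X × Y => h n z.1) - fun z => g z.2) 1 m =
        ENNReal.ofReal (∫ z, normSubProd g (h n) z ∂m) := fun n => by
      rw [eLpNorm_sub_comm, eLpNorm_one_eq_lintegral_enorm, ofReal_integral_eq_lintegral_ofReal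
        ((normSubProd g (h n)).integrable m) (.of_forall fun z => normSubProd_nonneg _ _ z)]
      exact lintegral_congr fun z => (ofReal_norm _).symm
    simp_rw [heq]
    rw [← ENNReal.ofReal_zero]
    refine ENNReal.tendsto_ofReal (squeeze_zero
      (fun n => integral_nonneg fun z => normSubProd_nonneg _ _ z)
      (fun n => (hh n).le) tendsto_one_div_add_atTop_nhds_zero_nat)
  obtain ⟨ns, -, hns⟩ :=
    (tendstoInMeasure_of_tendsto_eLpNorm one_ne_zero hmeas hgmeas hlim).exists_seq_tendsto_ae
  refine ⟨fun x => limsup (fun i => h (ns i) x) atTop,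
    .limsup fun i => (h (ns i)).continuous.measurable, ?_⟩
  filter_upwards [hns] with z hz using hz.limsup_eq

/-- If countably many continuous functions separate the points of `Y` and each of them is almost
surely a measurable function of `x`, then so is `y`. -/
lemma exists_measurable_ae_eq_of_injective {X Y : Type*} [MeasurableSpace X]
    [TopologicalSpace Y] [PolishSpace Y] [MeasurableSpace Y] [BorelSpace Y]
    (m : Measure (X × Y)) [Nonempty Y] {g : ℕ → Y →ᵇ ℝ}
    (hg : Function.Injective fun y k => g k y)
    (H : ∀ k, ∃ G : X → ℝ, Measurable G ∧ ∀ᵐ z ∂m, G z.1 = g k z.2) :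
    ∃ f : X → Y, Measurable f ∧ ∀ᵐ z ∂m, z.2 = f z.1 := by
  choose G hGm hG using H
  have hemb : MeasurableEmbedding fun y k => g k y :=
    (continuous_pi fun k => (g k).continuous).measurableEmbedding hg
  obtain ⟨r, hr, hrg⟩ := hemb.exists_measurable_extend measurable_id fun _ => ‹Nonempty Y›
  refine ⟨fun x => r fun k => G k x, hr.comp (measurable_pi_lambda _ hGm), ?_⟩
  filter_upwards [ae_all_iff.2 hG] with z hz
  simp_rw [hz]
  exact (congrFun hrg z.2).symm

/-- for `X`, `Y` Polish, the set of probability measures on `X × Y`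
concentrated on the graph of some Borel map `f : X → Y` is a Gδ subset of `𝒫(X × Y)`
with the topology of weak convergence. -/
theorem graph_measures_isGdelta
    {X Y : Type*}
    [TopologicalSpace X] [PolishSpace X] [MeasurableSpace X] [BorelSpace X]
    [TopologicalSpace Y] [PolishSpace Y] [MeasurableSpace Y] [BorelSpace Y] :
    IsGδ {m : ProbabilityMeasure (X × Y) |
      ∃ f : X → Y, Measurable f ∧ (m : Measure (X × Y)) {z : X × Y | z.2 = f z.1} = 1} := by
  obtain ⟨g, hg⟩ := exists_seq_boundedContinuous_injective Y
  have hgraph : ∀ (m : ProbabilityMeasure (X × Y)) {f : X → Y}, Measurable f →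
      ((m : Measure (X × Y)) {z : X × Y | z.2 = f z.1} = 1 ↔
        ∀ᵐ z ∂(m : Measure (X × Y)), z.2 = f z.1) := fun m f hf =>
    (mem_ae_iff_prob_eq_one
      (measurableSet_eq_fun measurable_snd (hf.comp measurable_fst))).symm
  have hset : {m : ProbabilityMeasure (X × Y) |
      ∃ f : X → Y, Measurable f ∧ (m : Measure (X × Y)) {z : X × Y | z.2 = f z.1} = 1} =
      ⋂ (k : ℕ) (n : ℕ), ⋃ h : X →ᵇ ℝ, {m : ProbabilityMeasure (X × Y) |
        ∫ z, normSubProd (g k) h z ∂(m : Measure (X × Y)) < 1 / ((n : ℝ) + 1)} := by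
    ext m
    simp only [Set.mem_ofPred_eq, Set.mem_iInter, Set.mem_iUnion]
    constructor
    · rintro ⟨f, hf, hm⟩ k n
      exact exists_integral_normSubProd_lt _ (g k) hf ((hgraph m hf).1 hm) Nat.one_div_pos_of_nat
    · intro H
      have : Nonempty Y :=
        (nonempty_of_isProbabilityMeasure (m : Measure (X × Y))).map Prod.snd
      obtain ⟨f, hf, hm⟩ := exists_measurable_ae_eq_of_injective (m : Measure (X × Y)) hg
        fun k => exists_measurable_ae_eq_of_integral_normSubProd_lt _ (g k) (H k)
      exact ⟨f, hf, (hgraph m hf).2 hm⟩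
  rw [hset]
  refine .iInter fun k => .iInter fun n => IsOpen.isGδ (isOpen_iUnion fun h => ?_)
  exact isOpen_lt
    (ProbabilityMeasure.continuous_integral_boundedContinuousFunction _) continuous_const
end

section
/- Let X and Y be Polish spaces. The set S := { m ∈ 𝒫(X × Y) : m(Graph(f)) = 1 for some Borel f : X → Y }, equipped with the subspace topology inherited from the topology of weak convergence on 𝒫(X × Y), is a Polish space (separable and completely metrizable). -/
open MeasureTheory

noncomputable section

open Filter Set Topology TopologicalSpace BoundedContinuousFunction
open scoped ENNReal unitInterval

/-- A `Gδ` subset of a Polish space is Polish. -/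
theorem IsGδ.polishSpace {α : Type*} [TopologicalSpace α] [PolishSpace α] {s : Set α}
    (hs : IsGδ s) : PolishSpace s := by
  obtain ⟨U, hU, rfl⟩ := isGδ_iff_eq_iInter_nat.1 hs
  have (n : ℕ) : PolishSpace (U n) := (hU n).polishSpace
  let e : (⋂ n, U n : Set α) → ∀ n, U n := fun x n ↦ ⟨x, mem_iInter.1 x.2 n⟩
  have he : Continuous e := by fun_prop
  have hind : IsInducing e := by
    refine .of_comp he ((continuous_apply 0).subtype_val) ?_
    exact IsInducing.subtypeVal
  have hrange : range e = {y | ∀ n, (y n : α) = y 0} := by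
    ext y
    refine ⟨?_, fun hy ↦ ?_⟩
    · rintro ⟨x, rfl⟩ n
      rfl
    · refine ⟨⟨y 0, mem_iInter.2 fun n ↦ hy n ▸ (y n).2⟩, funext fun n ↦ Subtype.ext (hy n).symm⟩
  have hcl : IsClosed (range e) := by
    rw [hrange, ofPred_forall]
    exact isClosed_iInter fun n ↦ isClosed_eq (by fun_prop) (by fun_prop)
  exact IsClosedEmbedding.polishSpace ⟨hind.isEmbedding, hcl⟩

/-- A Polish space embedded in a metrizable space is a `Gδ` subset. -/
theorem Topology.IsEmbedding.isGδ_range {α β : Type*} [TopologicalSpace α] [PolishSpace α]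
    [TopologicalSpace β] [MetrizableSpace β] {e : α → β} (he : IsEmbedding e) :
    IsGδ (range e) := by
  let := upgradeIsCompletelyMetrizable α
  let := metrizableSpaceMetric β
  let G : ℕ → Set β := fun n ↦
    ⋃₀ {U | IsOpen U ∧ ∀ x ∈ e ⁻¹' U, ∀ y ∈ e ⁻¹' U, dist x y < 1 / ((n : ℝ) + 1)}
  have hG (n : ℕ) : IsOpen (G n) := isOpen_sUnion fun U hU ↦ hU.1
  have hrange : range e = closure (range e) ∩ ⋂ n, G n := by
    apply Subset.antisymm
    · rintro _ ⟨x, rfl⟩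
      refine ⟨subset_closure ⟨x, rfl⟩, mem_iInter.2 fun n ↦ ?_⟩
      have hpos : (0 : ℝ) < 1 / ((n : ℝ) + 1) / 2 := by positivity
      obtain ⟨U, hU, hUe⟩ := he.isInducing.isOpen_iff.1
        (Metric.isOpen_ball (x := x) (ε := 1 / ((n : ℝ) + 1) / 2))
      refine ⟨U, ⟨hU, fun y hy z hz ↦ ?_⟩, ?_⟩
      · rw [hUe, Metric.mem_ball] at hy hz
        linarith [dist_triangle_right y z x]
      · rw [← mem_preimage, hUe]
        exact Metric.mem_ball_self hpos
    · rintro b ⟨hb, hbG⟩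
      have : (comap e (𝓝 b)).NeBot := by
        rw [comap_neBot_iff_frequently]
        exact mem_closure_iff_frequently.1 hb
      have hcauchy : Cauchy (comap e (𝓝 b)) := by
        refine Metric.cauchy_iff.2 ⟨this, fun ε hε ↦ ?_⟩
        obtain ⟨n, hn⟩ := exists_nat_one_div_lt hε
        obtain ⟨U, ⟨hU, hUd⟩, hbU⟩ := mem_iInter.1 hbG n
        exact ⟨e ⁻¹' U, preimage_mem_comap (hU.mem_nhds hbU),
          fun x hx y hy ↦ (hUd x hx y hy).trans hn⟩
      obtain ⟨a, ha⟩ := CompleteSpace.complete hcauchy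
      have h₁ : Tendsto e (comap e (𝓝 b)) (𝓝 (e a)) := (he.continuous.tendsto a).mono_left ha
      exact ⟨a, tendsto_nhds_unique h₁ tendsto_comap⟩
  rw [hrange]
  exact isClosed_closure.isGδ.inter (.iInter_of_isOpen hG)

namespace MeasureTheory.ProbabilityMeasure

/-- The mass of an open set is a lower semicontinuous function of the measure. -/
theorem isOpen_lt_measure {Ω : Type*} [TopologicalSpace Ω] [MetrizableSpace Ω]
    [MeasurableSpace Ω] [BorelSpace Ω] {G : Set Ω} (hG : IsOpen G) (c : ℝ≥0∞) :
    IsOpen {μ : ProbabilityMeasure Ω | c < (μ : Measure Ω) G} := by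
  rw [isOpen_iff_mem_nhds]
  intro μ hμ
  exact eventually_lt_of_lt_liminf
    (lt_of_lt_of_le hμ (le_liminf_measure_open_of_tendsto (μs := id) tendsto_id hG))

theorem isGδ_setOf_measure_eq_one_of_isOpen {Ω : Type*} [TopologicalSpace Ω] [MetrizableSpace Ω]
    [MeasurableSpace Ω] [BorelSpace Ω] {G : Set Ω} (hG : IsOpen G) :
    IsGδ {μ : ProbabilityMeasure Ω | (μ : Measure Ω) G = 1} := by
  obtain ⟨u, -, hu, hlim⟩ := exists_seq_strictMono_tendsto' (zero_lt_one (α := ℝ≥0∞))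
  have : {μ : ProbabilityMeasure Ω | (μ : Measure Ω) G = 1}
      = ⋂ n, {μ : ProbabilityMeasure Ω | u n < (μ : Measure Ω) G} := by
    ext μ
    simp only [mem_iInter, mem_ofPred_eq]
    refine ⟨fun h n ↦ h ▸ (hu n).2, fun h ↦ prob_le_one.antisymm ?_⟩
    exact le_of_tendsto' hlim fun n ↦ (h n).le
  rw [this]
  exact .iInter_of_isOpen fun n ↦ isOpen_lt_measure hG _

/-- The probability measures carried by a `Gδ` set form a `Gδ` set. -/
theorem isGδ_setOf_measure_eq_one {Ω : Type*} [TopologicalSpace Ω] [MetrizableSpace Ω]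
    [MeasurableSpace Ω] [BorelSpace Ω] {G : Set Ω} (hG : IsGδ G) :
    IsGδ {μ : ProbabilityMeasure Ω | (μ : Measure Ω) G = 1} := by
  obtain ⟨U, hU, rfl⟩ := isGδ_iff_eq_iInter_nat.1 hG
  have : {μ : ProbabilityMeasure Ω | (μ : Measure Ω) (⋂ n, U n) = 1}
      = ⋂ n, {μ : ProbabilityMeasure Ω | (μ : Measure Ω) (U n) = 1} := by
    ext μ
    simp only [mem_iInter, mem_ofPred_eq,
      ← mem_ae_iff_prob_eq_one (MeasurableSet.iInter fun n ↦ (hU n).measurableSet),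
      ← mem_ae_iff_prob_eq_one (hU _).measurableSet, countable_iInter_mem]
  rw [this]
  exact .iInter fun n ↦ isGδ_setOf_measure_eq_one_of_isOpen (hU n)

/-- Push-forward along an embedding of Polish spaces embeds the spaces of probability measures. -/
theorem isEmbedding_map {α β : Type*}
    [TopologicalSpace α] [PolishSpace α] [MeasurableSpace α] [BorelSpace α]
    [TopologicalSpace β] [PolishSpace β] [MeasurableSpace β] [BorelSpace β]
    {e : α → β} (he : IsEmbedding e) :
    IsEmbedding fun μ : ProbabilityMeasure α ↦ μ.map he.continuous.measurable.aemeasurable := by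
  let p : ProbabilityMeasure α → ProbabilityMeasure β := fun μ ↦
    μ.map he.continuous.measurable.aemeasurable
  refine IsInducing.isEmbedding (isInducing_iff_nhds.2 fun μ ↦ le_antisymm ?_ ?_)
  · exact (continuous_map he.continuous).continuousAt.le_comap
  · refine tendsto_of_forall_isOpen_le_liminf' (μs := id) (L := comap p (𝓝 (p μ))) fun G hG ↦ ?_
    obtain ⟨U, hU, rfl⟩ := he.isInducing.isOpen_iff.1 hG
    have h := le_liminf_measure_open_of_tendsto (tendsto_comap (x := 𝓝 (p μ)) (f := p)) hU
    simpa only [id, p, toMeasure_map,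
      Measure.map_apply he.continuous.measurable hU.measurableSet] using h

/-- The probability measures on a Polish space form a Polish space for weak convergence. -/
instance instPolishSpace {α : Type*} [TopologicalSpace α] [PolishSpace α]
    [MeasurableSpace α] [BorelSpace α] : PolishSpace (ProbabilityMeasure α) := by
  let := upgradeIsCompletelyMetrizable α
  obtain ⟨e, he⟩ := Metric.PiNatEmbed.exists_embedding_to_hilbert_cube (X := α)
  have hme : MeasurableEmbedding e := he.continuous.measurableEmbedding he.injective
  have : PolishSpace (ProbabilityMeasure (ℕ → I)) := by
    let := metrizableSpaceMetric (ProbabilityMeasure (ℕ → I))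
    infer_instance
  have hemb := isEmbedding_map he
  have hrange : range (fun μ : ProbabilityMeasure α ↦
      μ.map he.continuous.measurable.aemeasurable)
      = {ν : ProbabilityMeasure (ℕ → I) | (ν : Measure (ℕ → I)) (range e) = 1} := by
    ext ν
    refine ⟨?_, fun hν ↦ ?_⟩
    · rintro ⟨μ, rfl⟩
      simp [Measure.map_apply he.continuous.measurable hme.measurableSet_range]
    · have hmap : ((ν : Measure (ℕ → I)).comap e).map e = ν := by
        rw [hme.map_comap, Measure.restrict_eq_self_of_ae_mem]
        exact (mem_ae_iff_prob_eq_one hme.measurableSet_range).2 hν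
      have hprob : IsProbabilityMeasure ((ν : Measure (ℕ → I)).comap e) := by
        constructor
        rw [hme.comap_apply, image_univ]
        exact hν
      exact ⟨⟨_, hprob⟩, Subtype.ext hmap⟩
  have : PolishSpace (range fun μ : ProbabilityMeasure α ↦
      μ.map he.continuous.measurable.aemeasurable) := by
    rw [hrange]
    exact (isGδ_setOf_measure_eq_one he.isGδ_range).polishSpace
  exact hemb.toHomeomorph.isClosedEmbedding.polishSpace

end MeasureTheory.ProbabilityMeasure

/-- If `g ∘ Prod.snd` is an `L¹` limit of bounded continuous functions of the first coordinate, then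
it is almost everywhere a measurable function of the first coordinate. -/
theorem exists_measurable_ae_eq_fst {X Y : Type*} [TopologicalSpace X] [MeasurableSpace X]
    [BorelSpace X] [MeasurableSpace Y] {m : Measure (X × Y)} [IsProbabilityMeasure m] {g : Y → ℝ}
    (hg : Measurable g) (hbdd : ∀ y, |g y| ≤ 1)
    (h : ∀ k : ℕ, ∃ φ : X →ᵇ ℝ, ∫ z, |φ z.1 - g z.2| ∂m < 1 / ((k : ℝ) + 1)) :
    ∃ f : X → ℝ, Measurable f ∧ ∀ᵐ z ∂m, g z.2 = f z.1 := by
  choose φ hφ using h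
  have hφm (k : ℕ) : Measurable fun z : X × Y ↦ φ k z.1 :=
    (φ k).continuous.measurable.comp measurable_fst
  have hgm : Measurable fun z : X × Y ↦ g z.2 := hg.comp measurable_snd
  have hint (k : ℕ) : Integrable (fun z : X × Y ↦ φ k z.1 - g z.2) m := by
    refine .of_bound ((hφm k).sub hgm).aestronglyMeasurable (‖φ k‖ + 1) (ae_of_all _ fun z ↦ ?_)
    exact (norm_sub_le _ _).trans (add_le_add ((φ k).norm_coe_le_norm _) (hbdd _))
  have hlim : Tendsto (fun k ↦ eLpNorm ((fun z : X × Y ↦ φ k z.1) - fun z ↦ g z.2) 1 m) atTop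
      (𝓝 0) := by
    have h0 : Tendsto (fun k ↦ ENNReal.ofReal (∫ z, |φ k z.1 - g z.2| ∂m)) atTop (𝓝 0) := by
      rw [← ENNReal.ofReal_zero]
      refine ENNReal.tendsto_ofReal (squeeze_zero (fun k ↦ integral_nonneg fun z ↦ abs_nonneg _)
        (fun k ↦ (hφ k).le) tendsto_one_div_add_atTop_nhds_zero_nat)
    refine h0.congr fun k ↦ ?_
    rw [eLpNorm_one_eq_lintegral_enorm]
    exact ofReal_integral_norm_eq_lintegral_enorm (hint k)
  obtain ⟨ns, -, hns⟩ := (tendstoInMeasure_of_tendsto_eLpNorm one_ne_zero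
    (fun k ↦ (hφm k).aestronglyMeasurable) hgm.aestronglyMeasurable hlim).exists_seq_tendsto_ae
  refine ⟨fun x ↦ limUnder atTop fun i ↦ φ (ns i) x,
    (StronglyMeasurable.limUnder fun i ↦
      (φ (ns i)).continuous.measurable.stronglyMeasurable).measurable, ?_⟩
  filter_upwards [hns] with z hz
  exact hz.limUnder_eq.symm

/-- Being concentrated on the graph of a Borel map can be tested coordinatewise: each coordinate of
an injection of `Y` into the Hilbert cube is an `L¹` limit of bounded continuous functions of the
first variable. -/
theorem exists_measurable_graph_iff {X Y : Type*}
    [TopologicalSpace X] [PolishSpace X] [MeasurableSpace X] [BorelSpace X]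
    [TopologicalSpace Y] [PolishSpace Y] [MeasurableSpace Y] [BorelSpace Y]
    {e : Y → ℕ → I} (he : Continuous e) (hinj : Function.Injective e)
    (m : Measure (X × Y)) [IsProbabilityMeasure m] :
    (∃ f : X → Y, Measurable f ∧ m {z : X × Y | z.2 = f z.1} = 1) ↔
      ∀ i k : ℕ, ∃ φ : X →ᵇ ℝ, ∫ z, |φ z.1 - (e z.2 i : ℝ)| ∂m < 1 / ((k : ℝ) + 1) := by
  have hcoord (i : ℕ) : Measurable fun y ↦ (e y i : ℝ) :=
    (by fun_prop : Continuous fun y ↦ (e y i : ℝ)).measurable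
  have hbdd (i : ℕ) (y : Y) : |(e y i : ℝ)| ≤ 1 := by
    rw [abs_of_nonneg (e y i).2.1]
    exact (e y i).2.2
  have hae {f : X → Y} (hf : Measurable f) :
      m {z : X × Y | z.2 = f z.1} = 1 ↔ ∀ᵐ z ∂m, z.2 = f z.1 :=
    (mem_ae_iff_prob_eq_one
      (measurableSet_eq_fun measurable_snd (hf.comp measurable_fst))).symm
  constructor
  · rintro ⟨f, hf, hm⟩ i k
    rw [hae hf] at hm
    have hfi : Measurable fun x ↦ (e (f x) i : ℝ) := (hcoord i).comp hf
    have hprob : IsProbabilityMeasure (m.map Prod.fst) :=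
      Measure.isProbabilityMeasure_map measurable_fst.aemeasurable
    have hint : Integrable (fun x ↦ (e (f x) i : ℝ)) (m.map Prod.fst) :=
      .of_bound hfi.aestronglyMeasurable 1 (ae_of_all _ fun x ↦ hbdd i (f x))
    have hpos : (0 : ℝ) < 1 / ((k : ℝ) + 1) := by positivity
    obtain ⟨φ, hφ, -⟩ := hint.exists_boundedContinuous_integral_sub_le (half_pos hpos)
    refine ⟨φ, lt_of_le_of_lt ?_ (half_lt_self hpos)⟩
    rw [integral_map measurable_fst.aemeasurable
      (by fun_prop : Measurable fun x ↦ ‖(e (f x) i : ℝ) - φ x‖).aestronglyMeasurable] at hφ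
    refine le_of_eq_of_le (integral_congr_ae ?_) hφ
    filter_upwards [hm] with z hz
    rw [hz, abs_sub_comm, Real.norm_eq_abs]
  · intro h
    choose F hF hFm using fun i ↦
      exists_measurable_ae_eq_fst (hcoord i) (hbdd i) (h i)
    obtain ⟨z₀⟩ : Nonempty (X × Y) := nonempty_of_isProbabilityMeasure m
    let e' : Y → ℕ → ℝ := fun y i ↦ e y i
    have he' : Continuous e' := by fun_prop
    have hme : MeasurableEmbedding e' := he'.measurableEmbedding fun y y' hy ↦
      hinj (funext fun i ↦ Subtype.ext (congrFun hy i))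
    obtain ⟨r, hr, hre⟩ := hme.exists_measurable_extend measurable_id fun _ ↦ ⟨z₀.2⟩
    have hrF : Measurable fun x ↦ r fun i ↦ F i x := hr.comp (measurable_pi_lambda _ hF)
    refine ⟨_, hrF, (hae hrF).2 ?_⟩
    filter_upwards [ae_all_iff.2 hFm] with z hz
    rw [← funext hz]
    exact (congrFun hre z.2).symm

/-- for `X`, `Y` Polish, the set of probability measures on `X × Y`
concentrated on the graph of some Borel map `f : X → Y`, with the subspace topology
inherited from the topology of weak convergence on `𝒫(X × Y)`, is a Polish space. -/
theorem graph_measures_polishSpace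
    {X Y : Type*}
    [TopologicalSpace X] [PolishSpace X] [MeasurableSpace X] [BorelSpace X]
    [TopologicalSpace Y] [PolishSpace Y] [MeasurableSpace Y] [BorelSpace Y] :
    PolishSpace {m : ProbabilityMeasure (X × Y) //
      ∃ f : X → Y, Measurable f ∧ (m : Measure (X × Y)) {z : X × Y | z.2 = f z.1} = 1} := by
  obtain ⟨e, he⟩ : ∃ e : Y → ℕ → I, IsEmbedding e := by
    let := upgradeIsCompletelyMetrizable Y
    exact Metric.PiNatEmbed.exists_embedding_to_hilbert_cube
  let S : Set (ProbabilityMeasure (X × Y)) := {m | ∃ f : X → Y, Measurable f ∧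
    (m : Measure (X × Y)) {z : X × Y | z.2 = f z.1} = 1}
  suffices hS : IsGδ S from hS.polishSpace
  have hSeq : S = ⋂ (i : ℕ) (k : ℕ), ⋃ φ : X →ᵇ ℝ, {m : ProbabilityMeasure (X × Y) |
      ∫ z, |φ z.1 - (e z.2 i : ℝ)| ∂(m : Measure (X × Y)) < 1 / ((k : ℝ) + 1)} := by
    ext m
    simp only [S, mem_iInter, mem_iUnion, mem_ofPred_eq]
    exact exists_measurable_graph_iff he.continuous he.injective (m : Measure (X × Y))
  rw [hSeq]
  refine .iInter fun i ↦ .iInter_of_isOpen fun k ↦ isOpen_iUnion fun φ ↦ ?_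
  have hcont : Continuous e := he.continuous
  let ψ : X × Y →ᵇ ℝ := .ofNormedAddCommGroup (fun z ↦ |φ z.1 - (e z.2 i : ℝ)|)
    (by fun_prop) (‖φ‖ + 1) fun z ↦ by
      rw [Real.norm_eq_abs, abs_abs]
      refine (abs_sub _ _).trans (add_le_add (φ.norm_coe_le_norm _) ?_)
      rw [abs_of_nonneg (e z.2 i).2.1]
      exact (e z.2 i).2.2
  exact isOpen_lt (ProbabilityMeasure.continuous_integral_boundedContinuousFunction ψ)
    continuous_const
end
end

section
/- The image of the embedding I equals the set of graph-concentrated measures: I[𝒫(ℝ²)] = { P ∈ 𝒫(ℝ × 𝒫(ℝ)) : P(Graph(f)) = 1 for some Borel f : ℝ → 𝒫(ℝ) }, where 𝒫(ℝ) carries the weak topology and its Borel σ-algebra. -/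
open MeasureTheory ProbabilityTheory Filter
open scoped ENNReal NNReal Topology

noncomputable section

/-- `𝒫(ℝ)` (with its weak topology) carries the Borel σ-algebra. -/
instance : MeasurableSpace (ProbabilityMeasure ℝ) := borel _

instance : BorelSpace (ProbabilityMeasure ℝ) := ⟨rfl⟩

/-- The `p`-Wasserstein distance on measures on the line, w.r.t. the base metric `d̲`. -/
def Wp (p : ℝ) (dund : ℝ → ℝ → ℝ) (m m' : Measure ℝ) : ℝ≥0∞ :=
  (⨅ η : {η : Measure (ℝ × ℝ) // η ∈ coupling m m'},
      ∫⁻ q : ℝ × ℝ, ENNReal.ofReal (dund q.1 q.2 ^ p) ∂(η : Measure (ℝ × ℝ))) ^ (1 / p)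

/-- The regular conditional distribution `x ↦ μ^x` of the second coordinate given the
first, as a probability measure on `ℝ` (junk value for non-finite `μ`). -/
def condPM (μ : Measure (ℝ × ℝ)) (x : ℝ) : ProbabilityMeasure ℝ :=
  haveI := Classical.dec (IsFiniteMeasure μ)
  if h : IsFiniteMeasure μ then
    haveI := h
    ⟨μ.condKernel x, inferInstance⟩
  else ⟨Measure.dirac 0, inferInstance⟩

/-- The embedding `I : 𝒫(ℝ²) → 𝒫(ℝ × 𝒫(ℝ))`, `I[μ] = (x ↦ (x, μ^x))_* μ₁`. -/
def Iemb (μ : Measure (ℝ × ℝ)) : Measure (ℝ × ProbabilityMeasure ℝ) :=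
  (μ.map Prod.fst).map (fun x => (x, condPM μ x))

namespace MeasureTheory.ProbabilityMeasure

/-- The weak topology is the coarsest one making the integrals of nonnegative bounded continuous
functions continuous. -/
lemma topology_eq_iInf_induced_lintegral {Ω : Type*} [MeasurableSpace Ω] [TopologicalSpace Ω]
    [OpensMeasurableSpace Ω] :
    (inferInstance : TopologicalSpace (ProbabilityMeasure Ω)) =
      ⨅ g : BoundedContinuousFunction Ω ℝ≥0, TopologicalSpace.induced
        (fun ν : ProbabilityMeasure Ω => ∫⁻ ω, g ω ∂(ν : Measure Ω)) inferInstance := by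
  refine le_antisymm
    (le_iInf fun g => (continuous_lintegral_boundedContinuousFunction g).le_induced) ?_
  refine continuous_id_iff_le.1 ?_
  let : TopologicalSpace (ProbabilityMeasure Ω) :=
    ⨅ g : BoundedContinuousFunction Ω ℝ≥0, TopologicalSpace.induced
      (fun ν : ProbabilityMeasure Ω => ∫⁻ ω, g ω ∂(ν : Measure Ω)) inferInstance
  exact continuous_iff_forall_continuous_lintegral.2 fun g =>
    continuous_iInf_dom (i := g) continuous_induced_dom

/-- Pushing a probability measure on `ℝ` forward under the projection to `[-n, n]` approximates
it weakly as `n → ∞`. -/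
lemma tendsto_map_projIcc (ν : ProbabilityMeasure ℝ) :
    Tendsto (fun n : ℕ => (ν.map (f := Set.projIcc (-n : ℝ) n (by simp))
        continuous_projIcc.measurable.aemeasurable).map (f := Subtype.val)
        continuous_subtype_val.measurable.aemeasurable) atTop (𝓝 ν) := by
  refine tendsto_iff_forall_integral_tendsto.2 fun g => ?_
  have key : ∀ n : ℕ, ∫ x, g x ∂(((ν.map (f := Set.projIcc (-n : ℝ) n (by simp))
        continuous_projIcc.measurable.aemeasurable).map (f := Subtype.val)
        continuous_subtype_val.measurable.aemeasurable : ProbabilityMeasure ℝ) : Measure ℝ) =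
      ∫ x, g (Set.projIcc (-n : ℝ) n (by simp) x) ∂(ν : Measure ℝ) := by
    intro n
    rw [toMeasure_map, toMeasure_map,
      integral_map continuous_subtype_val.measurable.aemeasurable
        g.continuous.aestronglyMeasurable]
    exact integral_map continuous_projIcc.measurable.aemeasurable
      (g.continuous.comp continuous_subtype_val).aestronglyMeasurable
  simp_rw [key]
  refine tendsto_integral_of_dominated_convergence (fun _ => ‖g‖) (fun n =>
    (g.continuous.comp (continuous_subtype_val.comp continuous_projIcc)).aestronglyMeasurable)
    (integrable_const _) (fun n => ae_of_all _ fun x => g.norm_coe_le_norm _)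
    (ae_of_all _ fun x => ?_)
  obtain ⟨N, hN⟩ := exists_nat_ge |x|
  refine tendsto_const_nhds.congr' ?_
  filter_upwards [eventually_ge_atTop N] with n hn
  have hx : |x| ≤ n := hN.trans (by exact_mod_cast hn)
  rw [Set.projIcc_of_mem _ (abs_le.1 hx)]

instance : TopologicalSpace.SeparableSpace (ProbabilityMeasure ℝ) := by
  let ι : ∀ n : ℕ, ProbabilityMeasure (Set.Icc (-n : ℝ) n) → ProbabilityMeasure ℝ :=
    fun n ν => ν.map (f := Subtype.val) continuous_subtype_val.measurable.aemeasurable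
  have hsep : TopologicalSpace.IsSeparable (⋃ n, Set.range (ι n)) :=
    .iUnion fun n => by
      let := TopologicalSpace.metrizableSpaceMetric (ProbabilityMeasure (Set.Icc (-n : ℝ) n))
      exact TopologicalSpace.isSeparable_range (continuous_map continuous_subtype_val)
  have hdense : Dense (⋃ n, Set.range (ι n)) := fun ν =>
    mem_closure_of_tendsto (tendsto_map_projIcc ν)
      (Eventually.of_forall fun n => Set.mem_iUnion.2 ⟨n, Set.mem_range_self _⟩)
  rw [← TopologicalSpace.isSeparable_univ_iff, ← hdense.closure_eq]
  exact hsep.closure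

instance : SecondCountableTopology (ProbabilityMeasure ℝ) := by
  let := TopologicalSpace.metrizableSpaceMetric (ProbabilityMeasure ℝ)
  exact UniformSpace.secondCountable_of_separable _

/-- A map into `𝒫(ℝ)` that is measurable as a map into measures is Borel measurable for the weak
topology. -/
lemma measurable_of_measurable_toMeasure {α : Type*} [MeasurableSpace α]
    {f : α → ProbabilityMeasure ℝ} (hf : Measurable fun a => (f a : Measure ℝ)) :
    Measurable f := by
  have hgen := (topology_eq_iInf_induced_lintegral (Ω := ℝ)).trans
    (generateFrom_iUnion_isOpen _).symm
  rw [BorelSpace.measurable_eq (α := ProbabilityMeasure ℝ),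
    borel_eq_generateFrom_of_subbasis hgen]
  refine measurable_generateFrom fun s hs => ?_
  obtain ⟨g, U, hU, rfl⟩ := Set.mem_iUnion.1 hs
  exact ((Measure.measurable_lintegral
    g.continuous.measurable.coe_nnreal_ennreal).comp hf) hU.measurableSet

/-- The inclusion of `𝒫(ℝ)`, with the Borel σ-algebra of the weak topology, into measures is
measurable. -/
lemma measurable_toMeasure_of_borel :
    Measurable fun ν : ProbabilityMeasure ℝ => (ν : Measure ℝ) := by
  refine Measurable.measure_of_isPiSystem_of_isProbabilityMeasure
    ((BorelSpace.measurable_eq (α := ℝ)).trans borel_eq_generateFrom_isClosed)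
    isPiSystem_isClosed fun F (hF : IsClosed F) => ?_
  exact measurable_of_tendsto_metrizable
    (fun n => (continuous_lintegral_boundedContinuousFunction (hF.apprSeq n)).measurable)
    (tendsto_pi_nhds.2 fun ν => HasOuterApproxClosed.tendsto_lintegral_apprSeq hF ν)

end MeasureTheory.ProbabilityMeasure

lemma toMeasure_condPM (μ : Measure (ℝ × ℝ)) [h : IsFiniteMeasure μ] (x : ℝ) :
    (condPM μ x : Measure ℝ) = μ.condKernel x :=
  congrArg Subtype.val (dif_pos h)

lemma measurable_condPM (μ : Measure (ℝ × ℝ)) [IsFiniteMeasure μ] : Measurable (condPM μ) :=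
  ProbabilityMeasure.measurable_of_measurable_toMeasure <| by
    simpa only [toMeasure_condPM] using μ.condKernel.measurable

/-- A measure concentrated on the graph of `f` is the image of its first marginal under
`x ↦ (x, f x)`. -/
lemma MeasureTheory.Measure.map_fst_map_graph_eq_self {α β : Type*} [MeasurableSpace α]
    [MeasurableSpace β] {P : Measure (α × β)} {f : α → β} (hf : Measurable f)
    (hP : ∀ᵐ z ∂P, z.2 = f z.1) :
    (P.map Prod.fst).map (fun x => (x, f x)) = P := by
  rw [Measure.map_map (measurable_id'.prodMk hf) measurable_fst]
  conv_rhs => rw [← Measure.map_id (μ := P)]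
  refine Measure.map_congr ?_
  filter_upwards [hP] with z hz
  exact Prod.ext rfl hz.symm

/-- the image of the embedding `I` equals the set of graph-concentrated
probability measures on `ℝ × 𝒫(ℝ)`. -/
theorem Iemb_range_eq_graph_measures :
    {P : Measure (ℝ × ProbabilityMeasure ℝ) |
        ∃ μ : Measure (ℝ × ℝ), IsProbabilityMeasure μ ∧ P = Iemb μ} =
    {P : Measure (ℝ × ProbabilityMeasure ℝ) |
        IsProbabilityMeasure P ∧
        ∃ f : ℝ → ProbabilityMeasure ℝ, Measurable f ∧
          P {z : ℝ × ProbabilityMeasure ℝ | z.2 = f z.1} = 1} := by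
  ext P
  constructor
  · rintro ⟨μ, hμ, rfl⟩
    have hm : Measurable fun x => (x, condPM μ x) := measurable_id.prodMk (measurable_condPM μ)
    have : IsProbabilityMeasure (μ.map Prod.fst) :=
      Measure.isProbabilityMeasure_map measurable_fst.aemeasurable
    refine ⟨Measure.isProbabilityMeasure_map hm.aemeasurable, condPM μ, measurable_condPM μ, ?_⟩
    have hgraph : MeasurableSet {z : ℝ × ProbabilityMeasure ℝ | z.2 = condPM μ z.1} :=
      measurableSet_eq_fun measurable_snd
      ((measurable_condPM μ).comp measurable_fst)
    rw [Iemb, Measure.map_apply hm hgraph]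
    simp
  · rintro ⟨hP, f, hf, hPf⟩
    have hae : ∀ᵐ z ∂P, z.2 = f z.1 :=
      (mem_ae_iff_prob_eq_one
        (measurableSet_eq_fun measurable_snd (hf.comp measurable_fst))).2 hPf
    let κ : Kernel ℝ ℝ :=
      ⟨fun x => (f x : Measure ℝ), ProbabilityMeasure.measurable_toMeasure_of_borel.comp hf⟩
    have : IsMarkovKernel κ := ⟨fun x => (f x).2⟩
    have : IsProbabilityMeasure P.fst :=
      Measure.isProbabilityMeasure_map measurable_fst.aemeasurable
    have hfst : (P.fst ⊗ₘ κ).fst = P.fst := Measure.fst_compProd _ _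
    have hcond : ∀ᵐ x ∂P.fst, κ x = (P.fst ⊗ₘ κ).condKernel x := by
      simpa only [hfst] using
        eq_condKernel_of_measure_eq_compProd (ρ := P.fst ⊗ₘ κ) κ (by rw [hfst])
    refine ⟨P.fst ⊗ₘ κ, inferInstance, ?_⟩
    change P = (P.fst ⊗ₘ κ).fst.map _
    rw [hfst]
    refine (Measure.map_fst_map_graph_eq_self hf hae).symm.trans (Measure.map_congr ?_)
    filter_upwards [hcond] with x hx
    exact Prod.ext rfl (Subtype.ext (hx.trans (toMeasure_condPM _ x).symm))
end
end

section
/- Let ρ be a bounded metric compatible with the weak topology on 𝒫(ℝ) and let m be a Borel probability measure on ℝ × 𝒫(ℝ). Then m(Graph(f)) = 1 for some Borel f : ℝ → 𝒫(ℝ) if and only if inf{ ∫ ρ(F(x),ν) m(dx,dν) : F : ℝ → 𝒫(ℝ) continuous } = 0. -/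
open MeasureTheory Filter
open scoped ENNReal Topology

noncomputable section

/-- The mass of an open set is lower semicontinuous for the weak topology. -/
lemma lowerSemicontinuous_measure_isOpen {Ω : Type*} [MeasurableSpace Ω] [TopologicalSpace Ω]
    [OpensMeasurableSpace Ω] [HasOuterApproxClosed Ω] {G : Set Ω} (hG : IsOpen G) :
    LowerSemicontinuous (fun P : ProbabilityMeasure Ω => (P : Measure Ω) G) := by
  intro P y hy
  exact eventually_lt_of_lt_liminf
    (lt_of_lt_of_le hy (ProbabilityMeasure.le_liminf_measure_open_of_tendsto tendsto_id hG))

section Embedding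

variable {X Y : Type*} [MeasurableSpace X] [TopologicalSpace X] [BorelSpace X]
  [MeasurableSpace Y] [TopologicalSpace Y] [BorelSpace Y] {j : X → Y}

/-- Push-forward along an open embedding is an embedding for the weak topologies. -/
lemma isEmbedding_probabilityMeasure_map [HasOuterApproxClosed Y]
    [FirstCountableTopology (ProbabilityMeasure Y)] (hj : Topology.IsOpenEmbedding j) :
    Topology.IsEmbedding (fun P : ProbabilityMeasure X =>
      P.map hj.continuous.measurable.aemeasurable) := by
  have hmass : ∀ (P : ProbabilityMeasure X) (s : Set X),
      ((P.map hj.continuous.measurable.aemeasurable : ProbabilityMeasure Y) : Measure Y) (j '' s)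
        = (P : Measure X) s := by
    intro P s
    rw [ProbabilityMeasure.toMeasure_map, hj.measurableEmbedding.map_apply,
      Set.preimage_image_eq _ hj.injective]
  refine ⟨Topology.isInducing_iff_nhds.2 fun P => le_antisymm ?_ ?_, fun P Q hPQ => ?_⟩
  · exact (ProbabilityMeasure.continuous_map hj.continuous).continuousAt.tendsto.le_comap
  · refine tendsto_id'.1 (tendsto_of_forall_isOpen_le_liminf' fun G hG => ?_)
    have := ProbabilityMeasure.le_liminf_measure_open_of_tendsto
      (tendsto_comap (f := fun P : ProbabilityMeasure X =>
        P.map hj.continuous.measurable.aemeasurable)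
        (x := 𝓝 (P.map hj.continuous.measurable.aemeasurable))) (hj.isOpenMap G hG)
    simpa only [hmass, id] using this
  · refine Subtype.ext (Measure.ext fun s _ => ?_)
    change (P : Measure X) s = (Q : Measure X) s
    have := congrArg (fun R : ProbabilityMeasure Y => (R : Measure Y) (j '' s)) hPQ
    simpa only [hmass] using this

/-- The measures pushed forward along an open embedding are those giving full mass to its range. -/
lemma range_probabilityMeasure_map (hj : Topology.IsOpenEmbedding j) :
    Set.range (fun P : ProbabilityMeasure X => P.map hj.continuous.measurable.aemeasurable) =
      {Q : ProbabilityMeasure Y | (Q : Measure Y) (Set.range j) = 1} := by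
  ext Q
  constructor
  · rintro ⟨P, rfl⟩
    simp [hj.measurableEmbedding.map_apply]
  · intro hQ
    have hmap : ((Q : Measure Y).comap j).map j = Q := by
      rw [hj.measurableEmbedding.map_comap]
      refine Measure.restrict_eq_self_of_ae_mem ?_
      exact (prob_compl_eq_zero_iff hj.isOpen_range.measurableSet).2 hQ
    have : IsProbabilityMeasure (((Q : Measure Y).comap j).map j) := by
      rw [hmap]
      exact Q.2
    exact ⟨⟨(Q : Measure Y).comap j, Measure.isProbabilityMeasure_of_map j⟩, Subtype.ext hmap⟩

end Embedding

/-- `𝒫(ℝ)` embeds into the compact metrizable space of probability measures on the extended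
reals, with measurable range. -/
lemma exists_isEmbedding_polish_measurableSet_range :
    ∃ e : ProbabilityMeasure ℝ → ProbabilityMeasure EReal, Topology.IsEmbedding e ∧
      MeasurableSet[borel _] (Set.range e) := by
  refine ⟨_, isEmbedding_probabilityMeasure_map EReal.isOpenEmbedding_coe, ?_⟩
  rw [range_probabilityMeasure_map EReal.isOpenEmbedding_coe]
  borelize (ProbabilityMeasure EReal)
  exact (lowerSemicontinuous_measure_isOpen EReal.isOpenEmbedding_coe.isOpen_range).measurable
    (measurableSet_singleton 1)

instance : PolishSpace (ProbabilityMeasure EReal) := by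
  let := TopologicalSpace.metrizableSpaceMetric (ProbabilityMeasure EReal)
  infer_instance

instance : SecondCountableTopology (ProbabilityMeasure ℝ) :=
  exists_isEmbedding_polish_measurableSet_range.choose_spec.1.secondCountableTopology

/-- Being standard Borel transfers along a measurable equivalence. -/
lemma standardBorelSpace_of_measurableEquiv {α β : Type*} [MeasurableSpace α] [MeasurableSpace β]
    [StandardBorelSpace β] (e : α ≃ᵐ β) : StandardBorelSpace α := by
  let := upgradeStandardBorel β
  let : TopologicalSpace α := TopologicalSpace.induced e inferInstance
  refine ⟨_, ⟨?_⟩, e.toEquiv.polishSpace_induced⟩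
  exact e.measurableEmbedding.comap_eq.symm.trans
    ((congrArg (MeasurableSpace.comap e) (eq_borel_upgradeStandardBorel β)).trans borel_comap.symm)

instance : StandardBorelSpace (ProbabilityMeasure ℝ) := by
  obtain ⟨e, he, hrange⟩ := exists_isEmbedding_polish_measurableSet_range
  borelize (ProbabilityMeasure EReal)
  have := hrange.standardBorel
  exact standardBorelSpace_of_measurableEquiv (he.measurableEmbedding hrange).equivRange

/-- A measure concentrated on a measurable set with at most one point over each base point is
concentrated on the graph of a measurable function. -/
lemma exists_measurable_ae_snd_eq {α β : Type*} [MeasurableSpace α] [StandardBorelSpace α]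
    [MeasurableSpace β] [StandardBorelSpace β] [Nonempty β] {m : Measure (α × β)} {G : Set (α × β)}
    (hG : MeasurableSet G) (hinj : Set.InjOn Prod.fst G) (hm : ∀ᵐ z ∂m, z ∈ G) :
    ∃ f : α → β, Measurable f ∧ ∀ᵐ z ∂m, z.2 = f z.1 := by
  have := hG.standardBorel
  have hfst : MeasurableEmbedding (fun z : G => z.1.1) :=
    (measurable_fst.comp measurable_subtype_coe).measurableEmbedding hinj.injective
  refine ⟨Function.extend (fun z : G => z.1.1) (fun z => z.1.2) fun _ => Classical.arbitrary β,
    hfst.measurable_extend (measurable_snd.comp measurable_subtype_coe) measurable_const, ?_⟩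
  filter_upwards [hm] with z hz
  exact (hfst.injective.extend_apply (fun z : G => z.1.2) _ ⟨z, hz⟩).symm

/-- The convex combination of two probability measures with weights `p` and `1 - p`. -/
def mix {Ω : Type*} [MeasurableSpace Ω] (p : unitInterval) (P Q : ProbabilityMeasure Ω) :
    ProbabilityMeasure Ω :=
  ⟨unitInterval.toNNReal p • (P : Measure Ω) + unitInterval.toNNReal (unitInterval.symm p) • Q,
    inferInstance⟩

@[simp]
lemma mix_one {Ω : Type*} [MeasurableSpace Ω] (P Q : ProbabilityMeasure Ω) : mix 1 P Q = P :=
  Subtype.ext (by simp [mix])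

@[simp]
lemma mix_zero {Ω : Type*} [MeasurableSpace Ω] (P Q : ProbabilityMeasure Ω) : mix 0 P Q = Q :=
  Subtype.ext (by simp [mix])

lemma integral_mix {Ω : Type*} [MeasurableSpace Ω] [TopologicalSpace Ω] [OpensMeasurableSpace Ω]
    (p : unitInterval) (P Q : ProbabilityMeasure Ω) (g : BoundedContinuousFunction Ω ℝ) :
    ∫ ω, g ω ∂(mix p P Q : Measure Ω) =
      (p : ℝ) * ∫ ω, g ω ∂(P : Measure Ω) + (1 - (p : ℝ)) * ∫ ω, g ω ∂(Q : Measure Ω) := by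
  change ∫ ω, g ω ∂(unitInterval.toNNReal p • (P : Measure Ω) +
    unitInterval.toNNReal (unitInterval.symm p) • (Q : Measure Ω)) = _
  rw [integral_add_measure (g.integrable _) (g.integrable _), integral_smul_nnreal_measure,
    integral_smul_nnreal_measure]
  simp [NNReal.smul_def]

lemma continuous_mix {X Ω : Type*} [TopologicalSpace X] [MeasurableSpace Ω] [TopologicalSpace Ω]
    [OpensMeasurableSpace Ω] {p : X → unitInterval} {P Q : X → ProbabilityMeasure Ω}
    (hp : Continuous p) (hP : Continuous P) (hQ : Continuous Q) :
    Continuous (fun x => mix (p x) (P x) (Q x)) := by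
  refine continuous_iff_continuousAt.2 fun x =>
    ProbabilityMeasure.tendsto_iff_forall_integral_tendsto.2 fun g => ?_
  simp only [integral_mix]
  have hint : ∀ {R : X → ProbabilityMeasure Ω}, Continuous R →
      Tendsto (fun y => ∫ ω, g ω ∂(R y : Measure Ω)) (𝓝 x) (𝓝 (∫ ω, g ω ∂(R x : Measure Ω))) :=
    fun hR => ProbabilityMeasure.tendsto_iff_forall_integral_tendsto.1 hR.continuousAt g
  have hp' : Tendsto (fun y => (p y : ℝ)) (𝓝 x) (𝓝 (p x)) :=
    (continuous_subtype_val.comp hp).continuousAt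
  exact (hp'.mul (hint hP)).add ((hp'.const_sub 1).mul (hint hQ))

/-- A simple function with values in the probability measures agrees with a continuous function
outside a set of small measure. -/
lemma exists_continuous_measure_ne_le {X Ω : Type*} [MeasurableSpace X]
    [TopologicalSpace X] [TopologicalSpace.PseudoMetrizableSpace X] [BorelSpace X]
    [MeasurableSpace Ω] [TopologicalSpace Ω] [OpensMeasurableSpace Ω]
    [Nonempty (ProbabilityMeasure Ω)] (μ : Measure X) [IsFiniteMeasure μ]
    (s : SimpleFunc X (ProbabilityMeasure Ω)) :
    ∀ ε : ℝ≥0∞, ε ≠ 0 → ∃ F : X → ProbabilityMeasure Ω, Continuous F ∧ μ {x | F x ≠ s x} ≤ ε := by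
  induction s using SimpleFunc.induction' with
  | const c => exact fun ε _ => ⟨fun _ => c, continuous_const, by simp⟩
  | @pcw f g A hA hf hg =>
    intro ε hε
    have hε' : ε / 4 ≠ 0 := by simp [hε]
    obtain ⟨F, hF, hFf⟩ := hf (ε / 4) hε'
    obtain ⟨G, hG, hGg⟩ := hg (ε / 4) hε'
    obtain ⟨K, hKA, hK, hμK⟩ := hA.exists_isClosed_sdiff_lt (measure_ne_top μ A) hε'
    obtain ⟨L, hLA, hL, hμL⟩ := hA.compl.exists_isClosed_sdiff_lt (measure_ne_top μ Aᶜ) hε'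
    have hLK : Disjoint L K := (disjoint_compl_right.mono hKA hLA).symm
    obtain ⟨φ, hφL, hφK, hφ⟩ := exists_continuous_zero_one_of_isClosed hL hK hLK
    refine ⟨fun x => mix ⟨φ x, hφ x⟩ (F x) (G x),
      continuous_mix (φ.continuous.subtype_mk _) hF hG, ?_⟩
    have hsub : {x | mix ⟨φ x, hφ x⟩ (F x) (G x) ≠ f.piecewise A hA g x} ⊆
        ({x | F x ≠ f x} ∪ {x | G x ≠ g x}) ∪ (A \ K ∪ Aᶜ \ L) := by
      intro x hx
      by_contra hcon
      simp only [Set.mem_union, Set.mem_ofPred_eq, Set.mem_sdiff, Set.mem_compl_iff, not_or,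
        not_and, not_not] at hcon
      obtain ⟨⟨hxF, hxG⟩, hxK, hxL⟩ := hcon
      apply hx
      by_cases hxA : x ∈ A
      · have : (⟨φ x, hφ x⟩ : unitInterval) = 1 := Subtype.ext (hφK (hxK hxA))
        simp [this, hxA, hxF]
      · have : (⟨φ x, hφ x⟩ : unitInterval) = 0 := Subtype.ext (hφL (hxL hxA))
        simp [this, hxA, hxG]
    calc μ _ ≤ μ (({x | F x ≠ f x} ∪ {x | G x ≠ g x}) ∪ (A \ K ∪ Aᶜ \ L)) := measure_mono hsub
      _ ≤ (μ {x | F x ≠ f x} + μ {x | G x ≠ g x}) + (μ (A \ K) + μ (Aᶜ \ L)) :=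
        (measure_union_le _ _).trans (add_le_add (measure_union_le _ _) (measure_union_le _ _))
      _ ≤ (ε / 4 + ε / 4) + (ε / 4 + ε / 4) := by gcongr
      _ = ε := by
        rw [← two_mul, ← two_mul, ← mul_assoc, show (2 : ℝ≥0∞) * 2 = 4 by norm_num]
        exact ENNReal.mul_div_cancel (by norm_num) (by norm_num)

/-- let `ρ` be a bounded metric compatible with the weak topology on `𝒫(ℝ)`
and `m` a Borel probability measure on `ℝ × 𝒫(ℝ)`. Then `m` is concentrated on the graph
of a Borel map `f : ℝ → 𝒫(ℝ)` if and only if the infimum over continuous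
`F : ℝ → 𝒫(ℝ)` of `∫ ρ(F(x),ν) m(dx,dν)` is `0`. -/
theorem graph_concentration_iff_continuous_approx
    (ρ : ProbabilityMeasure ℝ → ProbabilityMeasure ℝ → ℝ)
    (hself : ∀ a, ρ a a = 0)
    (heq : ∀ a b, ρ a b = 0 → a = b)
    (hsymm : ∀ a b, ρ a b = ρ b a)
    (htri : ∀ a b c, ρ a c ≤ ρ a b + ρ b c)
    (hbdd : ∃ C : ℝ, ∀ a b, ρ a b ≤ C)
    (hcompat : ∀ (a : ProbabilityMeasure ℝ) (u : ℕ → ProbabilityMeasure ℝ),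
      Tendsto u atTop (nhds a) ↔ Tendsto (fun n => ρ (u n) a) atTop (nhds 0))
    (m : Measure (ℝ × ProbabilityMeasure ℝ)) [IsProbabilityMeasure m] :
    (∃ f : ℝ → ProbabilityMeasure ℝ, Measurable f ∧
        m {z : ℝ × ProbabilityMeasure ℝ | z.2 = f z.1} = 1) ↔
      (⨅ F : {F : ℝ → ProbabilityMeasure ℝ // Continuous F},
        ∫⁻ z : ℝ × ProbabilityMeasure ℝ, ENNReal.ofReal (ρ (F.1 z.1) z.2) ∂m) = 0 := by
  have hρ : Continuous fun q : ProbabilityMeasure ℝ × ProbabilityMeasure ℝ => ρ q.1 q.2 := by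
    refine SeqContinuous.continuous fun u q hu => ?_
    have h1 := (hcompat q.1 _).1 ((continuous_fst.tendsto q).comp hu)
    have h2 := (hcompat q.2 _).1 ((continuous_snd.tendsto q).comp hu)
    rw [tendsto_iff_dist_tendsto_zero]
    refine squeeze_zero (fun _ => dist_nonneg) (fun n => ?_) (by simpa using h1.add h2)
    rw [Real.dist_eq, abs_le]
    constructor
    · have := htri q.1 (u n).1 q.2
      have := htri (u n).1 (u n).2 q.2
      have := hsymm q.1 (u n).1
      simp only [Function.comp]
      linarith
    · have := htri (u n).1 q.1 (u n).2
      have := htri q.1 q.2 (u n).2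
      have := hsymm q.2 (u n).2
      simp only [Function.comp]
      linarith
  have hmeas : ∀ {Z : Type} [MeasurableSpace Z] {g h : Z → ProbabilityMeasure ℝ}, Measurable g →
      Measurable h → Measurable fun z => ENNReal.ofReal (ρ (g z) (h z)) := fun hg hh =>
    (hρ.measurable.comp (hg.prodMk hh)).ennreal_ofReal
  constructor
  · rintro ⟨f, hf, hfm⟩
    have hae : ∀ᵐ z ∂m, z.2 = f z.1 :=
      (prob_compl_eq_zero_iff
        (measurableSet_eq_fun measurable_snd (hf.comp measurable_fst))).2 hfm
    obtain ⟨C, hC⟩ := hbdd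
    let μ := m.map Prod.fst
    have : IsProbabilityMeasure μ := Measure.isProbabilityMeasure_map measurable_fst.aemeasurable
    let s := hf.stronglyMeasurable.approx
    have hs : Tendsto (fun n => ∫⁻ x, ENNReal.ofReal (ρ (s n x) (f x)) ∂μ) atTop (𝓝 0) := by
      have := tendsto_lintegral_of_dominated_convergence (μ := μ)
        (F := fun n x => ENNReal.ofReal (ρ (s n x) (f x))) (f := fun _ => 0)
        (fun _ => ENNReal.ofReal C) (fun n => hmeas (s n).measurable hf)
        (fun n => ae_of_all _ fun x => ENNReal.ofReal_le_ofReal (hC _ _)) (by simp)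
        (ae_of_all _ fun x => by
          simpa using ENNReal.tendsto_ofReal
            ((hcompat _ _).1 (hf.stronglyMeasurable.tendsto_approx x)))
      simpa using this
    refine le_antisymm (ENNReal.le_of_forall_pos_le_add fun ε hε _ => ?_) bot_le
    rw [zero_add]
    have hε2 : (0 : ℝ≥0∞) < ε / 2 := by simp [hε.ne']
    obtain ⟨n, hn⟩ := (hs.eventually_lt_const hε2).exists
    obtain ⟨F, hF, hFs⟩ := exists_continuous_measure_ne_le μ (s n)
      (ε / 2 / ENNReal.ofReal C) (by simp [hε.ne'])
    have hFs_meas : MeasurableSet {x | F x ≠ s n x} :=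
      (measurableSet_eq_fun hF.measurable (s n).measurable).compl
    calc _ ≤ ∫⁻ z, ENNReal.ofReal (ρ (F z.1) z.2) ∂m := iInf_le _ (⟨F, hF⟩ : {F // Continuous F})
      _ = ∫⁻ z, ENNReal.ofReal (ρ (F z.1) (f z.1)) ∂m :=
        lintegral_congr_ae (hae.mono fun z hz => by simp only [hz])
      _ = ∫⁻ x, ENNReal.ofReal (ρ (F x) (f x)) ∂μ :=
        (lintegral_map (hmeas hF.measurable hf) measurable_fst).symm
      _ ≤ ∫⁻ x, (ENNReal.ofReal (ρ (s n x) (f x)) +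
          {x | F x ≠ s n x}.indicator (fun _ => ENNReal.ofReal C) x) ∂μ := by
        refine lintegral_mono fun x => ?_
        by_cases hx : F x = s n x
        · simp [hx]
        · rw [Set.indicator_of_mem (by exact hx)]
          exact (ENNReal.ofReal_le_ofReal (hC _ _)).trans le_add_self
      _ = ∫⁻ x, ENNReal.ofReal (ρ (s n x) (f x)) ∂μ +
          ENNReal.ofReal C * μ {x | F x ≠ s n x} := by
        rw [lintegral_add_left (hmeas (s n).measurable hf), lintegral_indicator_const hFs_meas]
      _ ≤ ε / 2 + ε / 2 := by
        refine add_le_add hn.le ((mul_le_mul_right hFs _).trans ENNReal.mul_div_le)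
      _ = ε := ENNReal.add_halves _
  · intro h
    have hex : ∀ n : ℕ, ∃ F : ℝ → ProbabilityMeasure ℝ, Continuous F ∧
        ∫⁻ z, ENNReal.ofReal (ρ (F z.1) z.2) ∂m < 2⁻¹ ^ n := fun n => by
      obtain ⟨F, hF⟩ := iInf_lt_iff.1 (h.trans_lt (show (0 : ℝ≥0∞) < 2⁻¹ ^ n by
        exact ENNReal.pow_pos (by simp) n))
      exact ⟨F.1, F.2, hF⟩
    choose F hF hFint using hex
    have hρF : ∀ n, Measurable fun z : ℝ × ProbabilityMeasure ℝ =>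
        ENNReal.ofReal (ρ (F n z.1) z.2) :=
      fun n => hmeas ((hF n).measurable.comp measurable_fst) measurable_snd
    have hsum : ∫⁻ z, ∑' n, ENNReal.ofReal (ρ (F n z.1) z.2) ∂m ≠ ∞ := by
      rw [lintegral_tsum fun n => (hρF n).aemeasurable]
      refine ne_top_of_le_ne_top ?_ (ENNReal.tsum_le_tsum fun n => (hFint n).le)
      simp [ENNReal.tsum_geometric]
    have hG : MeasurableSet {z : ℝ × ProbabilityMeasure ℝ |
        Tendsto (fun n => ENNReal.ofReal (ρ (F n z.1) z.2)) atTop (𝓝 0)} :=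
      measurableSet_tendsto (𝓝 0) hρF
    have hlim : ∀ z : ℝ × ProbabilityMeasure ℝ,
        Tendsto (fun n => ENNReal.ofReal (ρ (F n z.1) z.2)) atTop (𝓝 0) →
        Tendsto (fun n => F n z.1) atTop (𝓝 z.2) := fun z hz => by
      have hnonneg : ∀ a b, 0 ≤ ρ a b := fun a b => by
        have := htri a b a
        rw [hself, hsymm b a] at this
        linarith
      rw [hcompat]
      have := (ENNReal.tendsto_toReal ENNReal.zero_ne_top).comp hz
      simpa [Function.comp_def, hnonneg] using this
    obtain ⟨f, hf, hfm⟩ := exists_measurable_ae_snd_eq (m := m) hG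
      (fun z hz w hw hzw => Prod.ext hzw (tendsto_nhds_unique (hlim z hz)
        (by simpa only [hzw] using hlim w hw)))
      ((ae_lt_top (Measurable.tsum hρF) hsum).mono fun z hz =>
        ENNReal.tendsto_atTop_zero_of_tsum_ne_top hz.ne)
    exact ⟨f, hf, (prob_compl_eq_zero_iff
      (measurableSet_eq_fun measurable_snd (hf.comp measurable_fst))).1 hfm⟩
end
end

section
/- Let μ, ν ∈ 𝒫^p(ℝ²) and let π be their Knothe–Rosenblatt rearrangement: with U₁, U₂ independent random variables uniform on (0,1), set X₁ := F_{μ₁}^{−1}(U₁), Y₁ := F_{ν₁}^{−1}(U₁), X₂ := F_{μ^{X₁}}^{−1}(U₂), Y₂ := F_{ν^{Y₁}}^{−1}(U₂), and let π be the law of ((X₁,X₂),(Y₁,Y₂)). Then π is a bicausal coupling of μ and ν, i.e., π ∈ Π_bc(μ,ν); consequently d_p^nd(μ,ν) ≤ d_p^KR(μ,ν) := ( ∫ d(x,y)^p π(dx,dy) )^{1/p}. -/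
open MeasureTheory ProbabilityTheory Filter
open scoped ENNReal NNReal Topology

noncomputable section

/-- A coupling `γ` on `ℝ² × ℝ²`, viewed as the joint law of two-stage processes
`X = (X₁,X₂)` and `Y = (Y₁,Y₂)`, is bicausal if for every Borel `B ⊆ ℝ` one has
`ℙ(Y₁ ∈ B | X₁,X₂) = ℙ(Y₁ ∈ B | X₁)` a.s. and `ℙ(X₁ ∈ B | Y₁,Y₂) = ℙ(X₁ ∈ B | Y₁)` a.s. -/
def Bicausal2 (γ : Measure ((ℝ × ℝ) × (ℝ × ℝ))) : Prop :=
  ∀ B : Set ℝ, MeasurableSet B →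
    (γ[fun z => Set.indicator B (fun _ => (1 : ℝ)) z.2.1 |
        MeasurableSpace.comap Prod.fst inferInstance]
      =ᵐ[γ]
     γ[fun z => Set.indicator B (fun _ => (1 : ℝ)) z.2.1 |
        MeasurableSpace.comap (fun z : (ℝ × ℝ) × (ℝ × ℝ) => z.1.1) inferInstance]) ∧
    (γ[fun z => Set.indicator B (fun _ => (1 : ℝ)) z.1.1 |
        MeasurableSpace.comap Prod.snd inferInstance]
      =ᵐ[γ]
     γ[fun z => Set.indicator B (fun _ => (1 : ℝ)) z.1.1 |
        MeasurableSpace.comap (fun z : (ℝ × ℝ) × (ℝ × ℝ) => z.2.1) inferInstance])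

/-- The `p`-th power cost `d(x,y)^p = d̲(x₁,y₁)^p + d̲(x₂,y₂)^p` on `ℝ² × ℝ²`. -/
def cost2 (p : ℝ) (dund : ℝ → ℝ → ℝ) (z : (ℝ × ℝ) × (ℝ × ℝ)) : ℝ≥0∞ :=
  ENNReal.ofReal (dund z.1.1 z.2.1 ^ p + dund z.1.2 z.2.2 ^ p)

/-- The nested distance `d_p^nd(μ,ν) = (inf_{γ ∈ Π_bc(μ,ν)} ∫ d^p dγ)^{1/p}` on `𝒫^p(ℝ²)`. -/
def nestedDist2 (p : ℝ) (dund : ℝ → ℝ → ℝ) (μ ν : Measure (ℝ × ℝ)) : ℝ≥0∞ :=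
  (⨅ γ : {γ : Measure ((ℝ × ℝ) × (ℝ × ℝ)) // γ ∈ coupling μ ν ∧ Bicausal2 γ},
      ∫⁻ z, cost2 p dund z ∂(γ : Measure _)) ^ (1 / p)

/-- Membership in `𝒫^p(ℝ²)`: a probability measure with a finite `p`-th moment. -/
def MemP2 (p : ℝ) (dund : ℝ → ℝ → ℝ) (μ : Measure (ℝ × ℝ)) : Prop :=
  IsProbabilityMeasure μ ∧
    ∃ x₀ : ℝ × ℝ, ∫⁻ x, cost2 p dund (x, x₀) ∂μ < ⊤

/-- The regular conditional distribution of the second coordinate given the first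
(with a junk value for non-finite measures). -/
def condK (μ : Measure (ℝ × ℝ)) : Kernel ℝ ℝ :=
  haveI := Classical.dec (IsFiniteMeasure μ)
  if h : IsFiniteMeasure μ then @Measure.condKernel ℝ ℝ _ _ _ _ μ h else 0

/-- The cdf of a measure on the line. -/
def cdfE (η : Measure ℝ) (y : ℝ) : ℝ≥0∞ := η (Set.Iic y)

/-- The left-continuous generalized inverse `F_η^{-1}(u) = inf { y : F_η(y) ≥ u }`. -/
def quantile (η : Measure ℝ) (u : ℝ) : ℝ :=
  sInf {y : ℝ | ENNReal.ofReal u ≤ cdfE η y}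

/-- The (increasing) Knothe–Rosenblatt rearrangement of `μ` and `ν`: the joint law of
`((X₁,X₂),(Y₁,Y₂))` where `X₁ = F_{μ₁}^{-1}(U₁)`, `Y₁ = F_{ν₁}^{-1}(U₁)`,
`X₂ = F_{μ^{X₁}}^{-1}(U₂)`, `Y₂ = F_{ν^{Y₁}}^{-1}(U₂)` for independent uniforms `U₁, U₂`. -/
def KR (μ ν : Measure (ℝ × ℝ)) : Measure ((ℝ × ℝ) × (ℝ × ℝ)) :=
  ((volume.restrict (Set.Ioo (0 : ℝ) 1)).prod (volume.restrict (Set.Ioo (0 : ℝ) 1))).map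
    (fun u =>
      ((quantile (μ.map Prod.fst) u.1,
        quantile (condK μ (quantile (μ.map Prod.fst) u.1)) u.2),
       (quantile (ν.map Prod.fst) u.1,
        quantile (condK ν (quantile (ν.map Prod.fst) u.1)) u.2)))

/-- The Knothe–Rosenblatt distance `d_p^KR(μ,ν) = (∫ d^p dπ)^{1/p}`, `π` the KR
rearrangement of `μ` and `ν`. -/
def dKR (p : ℝ) (dund : ℝ → ℝ → ℝ) (μ ν : Measure (ℝ × ℝ)) : ℝ≥0∞ :=
  (∫⁻ z, cost2 p dund z ∂(KR μ ν)) ^ (1 / p)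

/-- The uniform distribution on `(0,1)`. -/
abbrev uniformIoo : Measure ℝ := volume.restrict (Set.Ioo (0 : ℝ) 1)

instance isProbabilityMeasure_uniformIoo : IsProbabilityMeasure uniformIoo :=
  ⟨by simp [uniformIoo]⟩

/-- The Galois connection between the quantile function and the cdf. -/
theorem quantile_le_iff (η : Measure ℝ) [IsProbabilityMeasure η] {u : ℝ}
    (hu : u ∈ Set.Ioo (0 : ℝ) 1) (y : ℝ) :
    quantile η u ≤ y ↔ ENNReal.ofReal u ≤ η (Set.Iic y) := by
  have hcdf (x : ℝ) : ENNReal.ofReal u ≤ cdfE η x ↔ u ≤ cdf η x := by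
    rw [cdfE, ← ofReal_cdf, ENNReal.ofReal_le_ofReal_iff (cdf_nonneg η x)]
  have hset : {x : ℝ | ENNReal.ofReal u ≤ cdfE η x} = {x | u ≤ cdf η x} :=
    Set.ext hcdf
  obtain ⟨b, hb⟩ := ((tendsto_cdf_atBot η).eventually (gt_mem_nhds hu.1)).exists
  obtain ⟨t, ht⟩ := ((tendsto_cdf_atTop η).eventually (lt_mem_nhds hu.2)).exists
  have hbdd : BddBelow {x | u ≤ cdf η x} := by
    refine ⟨b, fun x hx => ?_⟩
    by_contra! hxb
    exact absurd (hx.trans (monotone_cdf η hxb.le)) (not_le.2 hb)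
  have hne : {x | u ≤ cdf η x}.Nonempty := ⟨t, ht.le⟩
  change _ ↔ ENNReal.ofReal u ≤ cdfE η y
  rw [hcdf, quantile, hset]
  refine ⟨fun h => ?_, fun h => csInf_le hbdd h⟩
  refine ge_of_tendsto (((cdf η).right_continuous y).mono Set.Ioi_subset_Ici_self) ?_
  filter_upwards [self_mem_nhdsWithin] with z hz
  obtain ⟨x, hx, hxz⟩ := exists_lt_of_csInf_lt hne (h.trans_lt hz)
  exact le_trans hx (monotone_cdf η hxz.le)

/-- The quantile function, set to zero outside `(0,1)`. -/
def quantileIoo (η : Measure ℝ) : ℝ → ℝ := (Set.Ioo (0 : ℝ) 1).indicator (quantile η)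

theorem quantileIoo_le_iff (η : Measure ℝ) [IsProbabilityMeasure η] (u y : ℝ) :
    quantileIoo η u ≤ y ↔ u ∈ Set.Ioo (0 : ℝ) 1 ∧ ENNReal.ofReal u ≤ η (Set.Iic y) ∨
      u ∉ Set.Ioo (0 : ℝ) 1 ∧ 0 ≤ y := by
  by_cases hu : u ∈ Set.Ioo (0 : ℝ) 1
  · simp only [quantileIoo, Set.indicator_of_mem hu, quantile_le_iff η hu, hu]
    simp
  · simp only [quantileIoo, Set.indicator_of_notMem hu, hu]
    simp

theorem measurable_quantileIoo_kernel {α : Type*} [MeasurableSpace α] (κ : Kernel α ℝ)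
    [IsMarkovKernel κ] : Measurable fun q : α × ℝ => quantileIoo (κ q.1) q.2 := by
  refine measurable_of_Iic fun y => ?_
  have hκ : Measurable fun q : α × ℝ => κ q.1 (Set.Iic y) :=
    (κ.measurable_coe measurableSet_Iic).comp measurable_fst
  have hI : MeasurableSet {q : α × ℝ | q.2 ∈ Set.Ioo (0 : ℝ) 1} :=
    measurable_snd measurableSet_Ioo
  simp only [Set.preimage, Set.mem_Iic, quantileIoo_le_iff]
  exact (hI.inter (measurableSet_le (ENNReal.measurable_ofReal.comp measurable_snd) hκ)).union
    (hI.compl.inter (MeasurableSet.const _))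

theorem Measurable.quantileIoo_kernel {α β : Type*} [MeasurableSpace α] [MeasurableSpace β]
    (κ : Kernel α ℝ) [IsMarkovKernel κ] {f : β → α} {g : β → ℝ} (hf : Measurable f)
    (hg : Measurable g) : Measurable fun b => quantileIoo (κ (f b)) (g b) := by
  have h := Measurable.comp (measurable_quantileIoo_kernel κ) (hf.prodMk hg)
  simpa only [Function.comp_def] using h

theorem measurable_quantileIoo (η : Measure ℝ) [IsProbabilityMeasure η] :
    Measurable (quantileIoo η) :=
  (measurable_quantileIoo_kernel (Kernel.const Unit η)).comp (measurable_prodMk_left (x := ()))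

/-- The quantile function of `η` transports the uniform distribution to `η`. -/
theorem map_quantileIoo (η : Measure ℝ) [IsProbabilityMeasure η] :
    uniformIoo.map (quantileIoo η) = η := by
  have hm := measurable_quantileIoo η
  have := Measure.isProbabilityMeasure_map (μ := uniformIoo) hm.aemeasurable
  refine Measure.ext_of_Iic _ _ fun y => ?_
  rw [Measure.map_apply hm measurableSet_Iic, Measure.restrict_apply (hm measurableSet_Iic),
    ← ofReal_cdf η y]
  have hset : quantileIoo η ⁻¹' Set.Iic y ∩ Set.Ioo 0 1 = Set.Ioo 0 1 ∩ Set.Iic (cdf η y) := by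
    ext u
    simp only [Set.mem_inter_iff, Set.mem_preimage, Set.mem_Iic, quantileIoo_le_iff,
      ← ofReal_cdf η y, ENNReal.ofReal_le_ofReal_iff (cdf_nonneg η y)]
    tauto
  rw [hset]
  apply le_antisymm
  · calc volume (Set.Ioo 0 1 ∩ Set.Iic (cdf η y)) ≤ volume (Set.Ioc 0 (cdf η y)) :=
          measure_mono fun u hu => ⟨hu.1.1, hu.2⟩
      _ = ENNReal.ofReal (cdf η y) := by simp
  · calc ENNReal.ofReal (cdf η y) = volume (Set.Ioo 0 (cdf η y)) := by simp
      _ ≤ volume (Set.Ioo 0 1 ∩ Set.Iic (cdf η y)) :=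
          measure_mono fun u hu => ⟨⟨hu.1, hu.2.trans_le (cdf_le_one η y)⟩, hu.2.le⟩

/-- Conditional sampling: applying the quantile function of `κ (a (T u₁))` to an independent
uniform variable adjoins to `T u₁` a coordinate with conditional law `κ ∘ a`. -/
theorem map_prod_quantileIoo_eq_compProd {α β : Type*} [MeasurableSpace α] [MeasurableSpace β]
    (κ : Kernel α ℝ) [IsMarkovKernel κ] {T : ℝ → β} (hT : Measurable T) {a : β → α}
    (ha : Measurable a) :
    (uniformIoo.prod uniformIoo).map (fun u => (T u.1, quantileIoo (κ (a (T u.1))) u.2)) =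
      uniformIoo.map T ⊗ₘ κ.comap a ha := by
  have hq : Measurable fun u : ℝ × ℝ => quantileIoo (κ (a (T u.1))) u.2 :=
    Measurable.quantileIoo_kernel κ ((ha.comp hT).comp measurable_fst) measurable_snd
  have hm : Measurable fun u : ℝ × ℝ => (T u.1, quantileIoo (κ (a (T u.1))) u.2) :=
    (hT.comp measurable_fst).prodMk hq
  have := Measure.isProbabilityMeasure_map (μ := uniformIoo) hT.aemeasurable
  ext s hs
  rw [Measure.map_apply hm hs, Measure.prod_apply (hm hs), Measure.compProd_apply hs,
    lintegral_map (Kernel.measurable_kernel_prodMk_left hs) hT]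
  refine lintegral_congr fun u => ?_
  rw [Kernel.comap_apply]
  conv_rhs => rw [← map_quantileIoo (κ (a (T u)))]
  rw [Measure.map_apply (measurable_quantileIoo _) (measurable_prodMk_left hs)]
  rfl

/-- If the conditional law of `X₂` given `(X₁, Y)` depends on `X₁` only, then conditioning events
of `Y` on `(X₁, X₂)` is the same as conditioning them on `X₁`. -/
theorem condExp_indicator_prodMk_ae_eq {Ω : Type*} [MeasurableSpace Ω] [StandardBorelSpace Ω]
    (γ : Measure Ω) [IsFiniteMeasure γ] {X₁ X₂ Y : Ω → ℝ} (hX₁ : Measurable X₁)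
    (hX₂ : Measurable X₂) (hY : Measurable Y) (κ : Kernel ℝ ℝ) [IsMarkovKernel κ]
    (hX : γ.map (fun ω => (X₁ ω, X₂ ω)) = γ.map X₁ ⊗ₘ κ)
    (hXY : γ.map (fun ω => ((X₁ ω, Y ω), X₂ ω)) =
      γ.map (fun ω => (X₁ ω, Y ω)) ⊗ₘ κ.prodMkRight ℝ)
    {B : Set ℝ} (hB : MeasurableSet B) :
    γ[fun ω => B.indicator (fun _ => (1 : ℝ)) (Y ω) |
        MeasurableSpace.comap (fun ω => (X₁ ω, X₂ ω)) inferInstance] =ᵐ[γ]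
      γ[fun ω => B.indicator (fun _ => (1 : ℝ)) (Y ω) |
        MeasurableSpace.comap X₁ inferInstance] := by
  have h₁ := condDistrib_ae_eq_of_measure_eq_compProd X₁ hX₂.aemeasurable hX
  have h₂ := condDistrib_ae_eq_of_measure_eq_compProd _ hX₂.aemeasurable hXY
  have h₃ : (condDistrib X₂ X₁ γ).prodMkRight ℝ =ᵐ[γ.map fun ω => (X₁ ω, Y ω)]
      κ.prodMkRight ℝ := by
    refine Measure.QuasiMeasurePreserving.ae_eq_comp (g := condDistrib X₂ X₁ γ) (g' := κ)
      (f := Prod.fst) (ν := γ.map X₁) ⟨measurable_fst, ?_⟩ h₁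
    rw [Measure.map_map measurable_fst (hX₁.prodMk hY)]
    exact Measure.AbsolutelyContinuous.rfl
  have hind := ((condIndepFun_iff_condDistrib_prod_ae_eq_prodMkRight hX₂ hY hX₁).2
    (h₂.trans h₃.symm)).symm
  have hdist := (condIndepFun_iff_condDistrib_prod_ae_eq_prodMkRight hY hX₂ hX₁).1 hind
  have hdist' := ae_of_ae_map (hX₁.prodMk hX₂).aemeasurable hdist
  refine (condDistrib_ae_eq_condExp (hX₁.prodMk hX₂) hY hB).symm.trans
    (EventuallyEq.trans ?_ (condDistrib_ae_eq_condExp hX₁ hY hB))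
  filter_upwards [hdist'] with ω hω
  rw [hω, Kernel.prodMkRight_apply]

theorem condK_eq_condKernel (μ : Measure (ℝ × ℝ)) [IsFiniteMeasure μ] :
    condK μ = μ.condKernel := by
  rw [condK, dif_pos]

instance isMarkovKernel_condK (μ : Measure (ℝ × ℝ)) [IsFiniteMeasure μ] :
    IsMarkovKernel (condK μ) := by
  rw [condK_eq_condKernel]; infer_instance

theorem map_fst_compProd_condK (μ : Measure (ℝ × ℝ)) [IsFiniteMeasure μ] :
    μ.map Prod.fst ⊗ₘ condK μ = μ := by
  rw [condK_eq_condKernel]; exact μ.disintegrate μ.condKernel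

/-- The Knothe–Rosenblatt transport of a pair of uniform variables to `μ`. -/
def rosenblatt (μ : Measure (ℝ × ℝ)) (u : ℝ × ℝ) : ℝ × ℝ :=
  (quantileIoo (μ.map Prod.fst) u.1,
    quantileIoo (condK μ (quantileIoo (μ.map Prod.fst) u.1)) u.2)

theorem KR_eq_map_rosenblatt (μ ν : Measure (ℝ × ℝ)) : KR μ ν =
    (uniformIoo.prod uniformIoo).map fun u => (rosenblatt μ u, rosenblatt ν u) := by
  refine Measure.map_congr ?_
  have hu : ∀ᵐ u ∂uniformIoo.prod uniformIoo,
      u ∈ Set.Ioo (0 : ℝ) 1 ×ˢ Set.Ioo (0 : ℝ) 1 := by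
    rw [uniformIoo, Measure.prod_restrict]
    exact ae_restrict_mem (measurableSet_Ioo.prod measurableSet_Ioo)
  filter_upwards [hu] with u hu
  simp only [rosenblatt, quantileIoo, Set.indicator_of_mem hu.1, Set.indicator_of_mem hu.2]

section Rosenblatt

variable (μ ν : Measure (ℝ × ℝ)) [IsProbabilityMeasure μ] [IsProbabilityMeasure ν]

instance isProbabilityMeasure_map_prod_fst : IsProbabilityMeasure (μ.map Prod.fst) :=
  Measure.isProbabilityMeasure_map measurable_fst.aemeasurable

theorem measurable_rosenblatt : Measurable (rosenblatt μ) := by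
  have h : Measurable fun u : ℝ × ℝ => quantileIoo (μ.map Prod.fst) u.1 :=
    (measurable_quantileIoo _).comp measurable_fst
  exact h.prodMk (Measurable.quantileIoo_kernel (condK μ) h measurable_snd)

theorem map_rosenblatt : (uniformIoo.prod uniformIoo).map (rosenblatt μ) = μ := by
  have h := map_prod_quantileIoo_eq_compProd (condK μ)
    (measurable_quantileIoo (μ.map Prod.fst)) measurable_id
  rw [map_quantileIoo, Kernel.comap_id, map_fst_compProd_condK] at h
  exact h

theorem condExp_map_rosenblatt {Ω : Type*} [MeasurableSpace Ω] [StandardBorelSpace Ω]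
    {Z : ℝ × ℝ → Ω} (hZ : Measurable Z) {X : Ω → ℝ × ℝ} (hX : Measurable X) {Y : Ω → ℝ}
    (hY : Measurable Y) (hXZ : ∀ u, X (Z u) = rosenblatt μ u)
    (hYZ : ∀ u, Y (Z u) = quantileIoo (ν.map Prod.fst) u.1)
    {B : Set ℝ} (hB : MeasurableSet B) :
    ((uniformIoo.prod uniformIoo).map Z)[fun ω => B.indicator (fun _ => (1 : ℝ)) (Y ω) |
        MeasurableSpace.comap X inferInstance] =ᵐ[(uniformIoo.prod uniformIoo).map Z]
      ((uniformIoo.prod uniformIoo).map Z)[fun ω => B.indicator (fun _ => (1 : ℝ)) (Y ω) |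
        MeasurableSpace.comap (fun ω => (X ω).1) inferInstance] := by
  have hX₁ : Measurable fun ω => (X ω).1 := measurable_fst.comp hX
  have hX₂ : Measurable fun ω => (X ω).2 := measurable_snd.comp hX
  have hq := measurable_quantileIoo (μ.map Prod.fst)
  have hT := hq.prodMk (measurable_quantileIoo (ν.map Prod.fst))
  have hfst {β : Type} [MeasurableSpace β] {f : ℝ → β} (hf : Measurable f) :
      (uniformIoo.prod uniformIoo).map (fun u => f u.1) = uniformIoo.map f := by
    have h := Measure.map_map (μ := uniformIoo.prod uniformIoo) hf measurable_fst
    rw [measurePreserving_fst.map_eq] at h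
    exact h.symm
  refine condExp_indicator_prodMk_ae_eq _ hX₁ hX₂ hY (condK μ) ?_ ?_ hB
  · rw [Measure.map_map (hX₁.prodMk hX₂) hZ, Measure.map_map hX₁ hZ]
    simp only [Function.comp_def, hXZ, rosenblatt]
    rw [hfst hq]
    simpa only [id, Kernel.comap_id] using
      map_prod_quantileIoo_eq_compProd (condK μ) hq measurable_id
  · rw [Measure.map_map ((hX₁.prodMk hY).prodMk hX₂) hZ, Measure.map_map (hX₁.prodMk hY) hZ]
    simp only [Function.comp_def, hXZ, hYZ, rosenblatt]
    rw [hfst hT]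
    exact map_prod_quantileIoo_eq_compProd (condK μ) hT measurable_fst

theorem KR_mem_coupling : KR μ ν ∈ coupling μ ν := by
  have h := (measurable_rosenblatt μ).prodMk (measurable_rosenblatt ν)
  rw [KR_eq_map_rosenblatt]
  constructor
  · rw [Measure.map_map measurable_fst h]
    exact map_rosenblatt μ
  · rw [Measure.map_map measurable_snd h]
    exact map_rosenblatt ν

theorem KR_bicausal : Bicausal2 (KR μ ν) := by
  have h := (measurable_rosenblatt μ).prodMk (measurable_rosenblatt ν)
  rw [KR_eq_map_rosenblatt]
  intro B hB
  exact ⟨condExp_map_rosenblatt μ ν h measurable_fst (measurable_fst.comp measurable_snd)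
      (fun _ => rfl) (fun _ => rfl) hB,
    condExp_map_rosenblatt ν μ h measurable_snd (measurable_fst.comp measurable_fst)
      (fun _ => rfl) (fun _ => rfl) hB⟩

end Rosenblatt

/-- the Knothe–Rosenblatt rearrangement `π` of `μ, ν ∈ 𝒫^p(ℝ²)` is a
bicausal coupling of `μ` and `ν`; consequently `d_p^nd(μ,ν) ≤ d_p^KR(μ,ν)`. -/
theorem KR_bicausal_and_nestedDist_le (p : ℝ) (hp : 1 ≤ p)
    (dund : ℝ → ℝ → ℝ) (hd : IsCompatibleMetric dund)
    (μ ν : Measure (ℝ × ℝ)) (hμ : MemP2 p dund μ) (hν : MemP2 p dund ν) :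
    KR μ ν ∈ coupling μ ν ∧ Bicausal2 (KR μ ν) ∧
    nestedDist2 p dund μ ν ≤ dKR p dund μ ν := by
  have := hμ.1
  have := hν.1
  refine ⟨KR_mem_coupling μ ν, KR_bicausal μ ν, ENNReal.rpow_le_rpow ?_ (by positivity)⟩
  exact iInf_le_of_le ⟨KR μ ν, KR_mem_coupling μ ν, KR_bicausal μ ν⟩ le_rfl
end
end
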